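/- For every labelled linear ordering M = (ℕ, <, P₁, …, Pₙ), the MSO theory of M is decidable if and only if each of the sets P₁, …, Pₙ is a computable subset of ℕ and there exists a computable set H ⊆ ℕ that is uniformly homogeneous for M. -/

import Mathlib

namespace Paper

/-! ## Syntax and semantics of monadic second-order logic over labelled linear orders

A labelled linear ordering `M = (A, <, P₁, …, Pₙ)` is represented by a type `A`,
a binary relation `r : A → A → Prop` (the order) and `P : Fin n → Set A`
(the unary predicates). -/

/-- MSO formulas over the signature `{<, P₀, …, P_{n-1}}`.  First-order
variables and second-order (set) variables are both indexed by `ℕ`. -/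
inductive MSO (n : ℕ) : Type
  | lt (i j : ℕ) : MSO n
  | pred (k : Fin n) (i : ℕ) : MSO n
  | mem (i j : ℕ) : MSO n
  | not (φ : MSO n) : MSO n
  | and (φ ψ : MSO n) : MSO n
  | ex1 (i : ℕ) (φ : MSO n) : MSO n
  | ex2 (j : ℕ) (φ : MSO n) : MSO n

namespace MSO

variable {n : ℕ}

/-- Satisfaction of an MSO formula in the structure `(A, r, P)` under the
first-order assignment `v` and the second-order assignment `V`. -/
def Sat {A : Type} (r : A → A → Prop) (P : Fin n → Set A)
    (v : ℕ → A) (V : ℕ → Set A) : MSO n → Prop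
  | lt i j => r (v i) (v j)
  | pred k i => v i ∈ P k
  | mem i j => v i ∈ V j
  | not φ => ¬ Sat r P v V φ
  | and φ ψ => Sat r P v V φ ∧ Sat r P v V ψ
  | ex1 i φ => ∃ a : A, Sat r P (Function.update v i a) V φ
  | ex2 j φ => ∃ S : Set A, Sat r P v (Function.update V j S) φ

/-- Quantifier depth of an MSO formula. -/
def qd : MSO n → ℕ
  | lt _ _ => 0
  | pred _ _ => 0
  | mem _ _ => 0
  | not φ => qd φ
  | and φ ψ => max (qd φ) (qd ψ)
  | ex1 _ φ => qd φ + 1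
  | ex2 _ φ => qd φ + 1

/-- Free first-order variables of an MSO formula. -/
def fv1 : MSO n → Finset ℕ
  | lt i j => {i, j}
  | pred _ i => {i}
  | mem i _ => {i}
  | not φ => fv1 φ
  | and φ ψ => fv1 φ ∪ fv1 ψ
  | ex1 i φ => fv1 φ \ {i}
  | ex2 _ φ => fv1 φ

/-- Free second-order variables of an MSO formula. -/
def fv2 : MSO n → Finset ℕ
  | lt _ _ => ∅
  | pred _ _ => ∅
  | mem _ j => {j}
  | not φ => fv2 φ
  | and φ ψ => fv2 φ ∪ fv2 ψ
  | ex1 _ φ => fv2 φ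
  | ex2 j φ => fv2 φ \ {j}

/-- A sentence is a formula with no free variables. -/
def IsSentence (φ : MSO n) : Prop := fv1 φ = ∅ ∧ fv2 φ = ∅

/-- A sentence `φ` is true in the structure `(A, r, P)`. -/
def TrueIn {A : Type} (r : A → A → Prop) (P : Fin n → Set A) (φ : MSO n) : Prop :=
  ∀ (v : ℕ → A) (V : ℕ → Set A), Sat r P v V φ

/-- `Q ⊆ A` is MSO-definable in `(A, r, P)`: there is a formula `φ(x)` whose only
free variable is the first-order variable `0` defining `Q`. -/
def Definable {A : Type} (r : A → A → Prop) (P : Fin n → Set A) (Q : Set A) : Prop :=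
  ∃ φ : MSO n, fv1 φ ⊆ {0} ∧ fv2 φ = ∅ ∧
    ∀ a : A, a ∈ Q ↔ ∀ (v : ℕ → A) (V : ℕ → Set A), Sat r P (Function.update v 0 a) V φ

/-- A Gödel numbering of MSO formulas. -/
def encode : MSO n → ℕ
  | lt i j => Nat.pair 0 (Nat.pair i j)
  | pred k i => Nat.pair 1 (Nat.pair k i)
  | mem i j => Nat.pair 2 (Nat.pair i j)
  | not φ => Nat.pair 3 (encode φ)
  | and φ ψ => Nat.pair 4 (Nat.pair (encode φ) (encode ψ))
  | ex1 i φ => Nat.pair 5 (Nat.pair i (encode φ))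
  | ex2 j φ => Nat.pair 6 (Nat.pair j (encode φ))

/-- The MSO theory of the structure `(A, r, P)`, as a set of Gödel codes of the true
sentences. -/
def TheoryCodes {A : Type} (r : A → A → Prop) (P : Fin n → Set A) : Set ℕ :=
  {c | ∃ φ : MSO n, IsSentence φ ∧ encode φ = c ∧ TrueIn r P φ}

/-- Two structures have the same `k`-type: they satisfy the same MSO sentences of
quantifier depth `≤ k`. -/
def EquivType (k : ℕ) {A B : Type} (r : A → A → Prop) (P : Fin n → Set A)
    (s : B → B → Prop) (Q : Fin n → Set B) : Prop :=
  ∀ φ : MSO n, IsSentence φ → qd φ ≤ k → (TrueIn r P φ ↔ TrueIn s Q φ)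

/-- The `k`-type of a structure, as the set of Gödel codes of the true sentences
of quantifier depth `≤ k`. -/
def TypeSet (k : ℕ) {A : Type} (r : A → A → Prop) (P : Fin n → Set A) : Set ℕ :=
  {c | ∃ φ : MSO n, IsSentence φ ∧ qd φ ≤ k ∧ encode φ = c ∧ TrueIn r P φ}

end MSO

/-- The order relation of the substructure with domain `S`. -/
def subRel {A : Type} (r : A → A → Prop) (S : Set A) : S → S → Prop :=
  fun x y => r x y

/-- The predicates of the substructure with domain `S`. -/
def subPred {A : Type} {n : ℕ} (P : Fin n → Set A) (S : Set A) : Fin n → Set S :=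
  fun k => {x : S | (x : A) ∈ P k}

/-! ## Relative computability -/

/-- Partial recursiveness relative to an oracle `O` (Kleene-style, following
the definition of `Nat.Partrec`, with an extra base case for the oracle). -/
inductive RecursiveIn (O : ℕ →. ℕ) : (ℕ →. ℕ) → Prop
  | zero : RecursiveIn O (pure 0)
  | succ : RecursiveIn O ↑Nat.succ
  | left : RecursiveIn O ↑fun n : ℕ => n.unpair.1
  | right : RecursiveIn O ↑fun n : ℕ => n.unpair.2
  | oracle : RecursiveIn O O
  | pair {f g} : RecursiveIn O f → RecursiveIn O g →
      RecursiveIn O fun n => Nat.pair <$> f n <*> g n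
  | comp {f g} : RecursiveIn O f → RecursiveIn O g →
      RecursiveIn O fun n => g n >>= f
  | prec {f g} : RecursiveIn O f → RecursiveIn O g →
      RecursiveIn O (Nat.unpaired fun a m =>
        m.rec (f a) fun y IH => do let i ← IH; g (Nat.pair a (Nat.pair y i)))
  | rfind {f} : RecursiveIn O f →
      RecursiveIn O fun a => Nat.rfind fun m => (fun x => x = 0) <$> f (Nat.pair a m)

/-- The characteristic (partial) function of a set of naturals. -/
noncomputable def chi (S : Set ℕ) : ℕ →. ℕ :=
  fun m => Part.some (S.indicator (fun _ => 1) m)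

/-- `S` is recursive in (Turing reducible to) `T`. -/
def TuringRed (S T : Set ℕ) : Prop := RecursiveIn (chi T) (chi S)

/-- The (recursive) join of a finite family of sets of naturals. -/
def finJoin {m : ℕ} (P : Fin m → Set ℕ) : Set ℕ :=
  {c | ∃ i : Fin m, ∃ x : ℕ, c = Nat.pair i x ∧ x ∈ P i}

/-- The (recursive) join of two sets of naturals. -/
def setJoin (S T : Set ℕ) : Set ℕ :=
  {c | (∃ a, c = 2 * a ∧ a ∈ S) ∨ (∃ a, c = 2 * a + 1 ∧ a ∈ T)}

/-- A set of naturals is decidable (computable). -/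
def DecidableSet (S : Set ℕ) : Prop := ComputablePred (· ∈ S)

/-! ## Homogeneous sets for labelled orderings of the naturals -/

/-- `H = {h 0 < h 1 < ⋯}` is `k`-homogeneous for `(ℕ, <, P)`:
all substructures `M_{[h i, h j)}`, `i < j`, have the same `k`-type. -/
def KHomogeneous {n : ℕ} (P : Fin n → Set ℕ) (h : ℕ → ℕ) (k : ℕ) : Prop :=
  ∀ i j i' j' : ℕ, i < j → i' < j' →
    MSO.EquivType k
      (subRel (· < ·) (Set.Ico (h i) (h j))) (subPred P (Set.Ico (h i) (h j)))
      (subRel (· < ·) (Set.Ico (h i') (h j'))) (subPred P (Set.Ico (h i') (h j')))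

/-- `H = {h 0 < h 1 < ⋯}` is uniformly homogeneous for `(ℕ, <, P)`:
for each `k`, the set `{h k < h (k+1) < ⋯}` is `k`-homogeneous. -/
def UniformlyHomogeneous {n : ℕ} (P : Fin n → Set ℕ) (h : ℕ → ℕ) : Prop :=
  StrictMono h ∧
  ∀ k : ℕ, KHomogeneous P (fun i => h (k + i)) k

/-! ## ℤ-words -/

/-- The finite word `u` occurs at position `i` in the `ℤ`-word `w`. -/
def OccursAt {σ : Type} (w : ℤ → σ) (u : List σ) (i : ℤ) : Prop :=
  ∀ k : Fin u.length, w (i + (k : ℕ)) = u.get k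

/-- The finite word `u` occurs in the `ℤ`-word `w`. -/
def OccursIn {σ : Type} (w : ℤ → σ) (u : List σ) : Prop :=
  ∃ i : ℤ, OccursAt w u i

/-- `u` occurs in every prefix of `w`. -/
def InEveryPrefix {σ : Type} (w : ℤ → σ) (u : List σ) : Prop :=
  ∀ n : ℤ, ∃ i : ℤ, i + u.length ≤ n ∧ OccursAt w u i

/-- `u` occurs in every suffix of `w`. -/
def InEverySuffix {σ : Type} (w : ℤ → σ) (u : List σ) : Prop :=
  ∀ n : ℤ, ∃ i : ℤ, n ≤ i ∧ OccursAt w u i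

/-- A `ℤ`-word `w` is recurrent: for every regular language `X`, either no element
of `X` occurs in `w`, or every prefix and every suffix of `w` contains an
occurrence of some element of `X`. -/
def Recurrent {σ : Type} (w : ℤ → σ) : Prop :=
  ∀ X : Language σ, X.IsRegular →
    (∀ u ∈ X, ¬ OccursIn w u) ∨
    (∀ n : ℤ, (∃ u ∈ X, ∃ i : ℤ, i + u.length ≤ n ∧ OccursAt w u i) ∧
              (∃ u ∈ X, ∃ i : ℤ, n ≤ i ∧ OccursAt w u i))

/-- The `ℤ`-word `w(M)` over the alphabet `{0,1}ⁿ` associated with the labelled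
linear ordering `M = (ℤ, <, P₁, …, Pₙ)`. -/
def wordOf {n : ℕ} (P : Fin n → Set ℤ) : ℤ → (Fin n → Prop) :=
  fun i k => i ∈ P k

end Paper

namespace Paper

/-! ## Finite types of labelled suborders of `ℕ`

A structure is given by a domain `D : Set ℕ` and a family `Q : ℕ → Set ℕ` of labels, of which only
the first `m` matter.  First-order elements are represented by singleton labels. -/

/-- The labels `Q i` and `Q j` meet inside `D`. -/
def Meets (D : Set ℕ) (Q : ℕ → Set ℕ) (i j : ℕ) : Prop :=
  ∃ x ∈ D, x ∈ Q i ∧ x ∈ Q j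

/-- Some element of `Q i` precedes some element of `Q j` inside `D`. -/
def Precedes (D : Set ℕ) (Q : ℕ → Set ℕ) (i j : ℕ) : Prop :=
  ∃ x ∈ D, ∃ y ∈ D, x ∈ Q i ∧ y ∈ Q j ∧ x < y

/-- The possible back-and-forth types of depth `k` of structures with `m` labels. -/
def Ty : ℕ → ℕ → Type
  | 0, m => Set (Fin m × Fin m) × Set (Fin m × Fin m)
  | k + 1, m => Set (Ty k (m + 1))

/-- The back-and-forth type of depth `k` of the structure `D` labelled by `Q 0, …, Q (m - 1)`. -/
def typ : (k m : ℕ) → Set ℕ → (ℕ → Set ℕ) → Ty k m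
  | 0, _, D, Q => ({ij | Meets D Q ij.1 ij.2}, {ij | Precedes D Q ij.1 ij.2})
  | k + 1, m, D, Q => Set.range fun S => typ k (m + 1) D (Function.update Q m S)

instance instFiniteTy : (k m : ℕ) → Finite (Ty k m)
  | 0, m => inferInstanceAs (Finite (Set (Fin m × Fin m) × Set (Fin m × Fin m)))
  | k + 1, m =>
    haveI := instFiniteTy k (m + 1)
    inferInstanceAs (Finite (Set (Ty k (m + 1))))

/-- A bound on the number of types of depth `k` with `s - k` labels. -/
def tyBound (k s : ℕ) : ℕ := (fun x => 2 ^ x)^[k] (2 ^ (s * s) * 2 ^ (s * s))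

theorem card_ty_le : ∀ k m : ℕ, Nat.card (Ty k m) ≤ tyBound k (k + m)
  | 0, m => by
    change Nat.card (Set (Fin m × Fin m) × Set (Fin m × Fin m)) ≤ _
    simp [tyBound, Nat.card_eq_fintype_card]
  | k + 1, m => by
    change Nat.card (Set (Ty k (m + 1))) ≤ _
    have := card_ty_le k (m + 1)
    have : Fintype (Ty k (m + 1)) := Fintype.ofFinite _
    rw [Nat.card_eq_fintype_card, Fintype.card_set, ← Nat.card_eq_fintype_card, tyBound,
      Function.iterate_succ_apply']
    refine Nat.pow_le_pow_right (by norm_num) ?_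
    rw [show k + 1 + m = k + (m + 1) by ring]
    assumption

section typ

variable {k m : ℕ} {D D' : Set ℕ} {Q Q' : ℕ → Set ℕ}

theorem typ_zero_eq_iff : typ 0 m D Q = typ 0 m D' Q' ↔
    ∀ i < m, ∀ j < m, (Meets D Q i j ↔ Meets D' Q' i j) ∧
      (Precedes D Q i j ↔ Precedes D' Q' i j) := by
  constructor
  · intro h i hi j hj
    have h1 := congrArg (fun t : Set (Fin m × Fin m) × Set (Fin m × Fin m) =>
      ((⟨i, hi⟩, ⟨j, hj⟩) : Fin m × Fin m) ∈ t.1) h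
    have h2 := congrArg (fun t : Set (Fin m × Fin m) × Set (Fin m × Fin m) =>
      ((⟨i, hi⟩, ⟨j, hj⟩) : Fin m × Fin m) ∈ t.2) h
    exact ⟨iff_of_eq h1, iff_of_eq h2⟩
  · intro h
    refine Prod.ext ?_ ?_
    · ext ⟨i, j⟩
      exact (h i i.2 j j.2).1
    · ext ⟨i, j⟩
      exact (h i i.2 j j.2).2

theorem typ_succ_eq_iff : typ (k + 1) m D Q = typ (k + 1) m D' Q' ↔
    (∀ S, ∃ S', typ k (m + 1) D (Function.update Q m S) =
      typ k (m + 1) D' (Function.update Q' m S')) ∧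
    ∀ S', ∃ S, typ k (m + 1) D (Function.update Q m S) =
      typ k (m + 1) D' (Function.update Q' m S') := by
  change Set.range _ = Set.range _ ↔ _
  constructor
  · intro h
    refine ⟨fun S => ?_, fun S' => ?_⟩
    · obtain ⟨S', h'⟩ := h.subset ⟨S, rfl⟩
      exact ⟨S', h'.symm⟩
    · obtain ⟨S, h'⟩ := h.superset ⟨S', rfl⟩
      exact ⟨S, h'⟩
  · rintro ⟨h1, h2⟩
    apply Set.Subset.antisymm
    · rintro _ ⟨S, rfl⟩
      obtain ⟨S', h'⟩ := h1 S
      exact ⟨S', h'.symm⟩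
    · rintro _ ⟨S', rfl⟩
      obtain ⟨S, h'⟩ := h2 S'
      exact ⟨S, h'⟩

theorem typ_atoms {i j : ℕ} (hi : i < m) (hj : j < m) (h : typ k m D Q = typ k m D' Q') :
    (Meets D Q i j ↔ Meets D' Q' i j) ∧ (Precedes D Q i j ↔ Precedes D' Q' i j) := by
  induction k generalizing m Q Q' with
  | zero => exact typ_zero_eq_iff.1 h i hi j hj
  | succ k ih =>
    obtain ⟨S', h'⟩ := (typ_succ_eq_iff.1 h).1 ∅
    have := ih (by omega) (by omega) h'
    simpa [Meets, Precedes, Function.update_of_ne hi.ne, Function.update_of_ne hj.ne] using this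

/-- Types are invariant under isomorphisms. -/
theorem typ_image {f : ℕ → ℕ} (hf : StrictMonoOn f D)
    (hQ : ∀ i < m, ∀ x ∈ D, x ∈ Q i ↔ f x ∈ Q' i) :
    typ k m D Q = typ k m (f '' D) Q' := by
  induction k generalizing m Q Q' with
  | zero =>
    refine typ_zero_eq_iff.2 fun i hi j hj => ⟨?_, ?_⟩
    · simp only [Meets, Set.exists_mem_image]
      exact exists_congr fun x => and_congr_right fun hx => by rw [hQ i hi x hx, hQ j hj x hx]
    · simp only [Precedes, Set.exists_mem_image]
      refine exists_congr fun x => and_congr_right fun hx => exists_congr fun y =>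
        and_congr_right fun hy => ?_
      rw [hQ i hi x hx, hQ j hj y hy, hf.lt_iff_lt hx hy]
  | succ k ih =>
    refine typ_succ_eq_iff.2 ⟨fun S => ⟨f '' (S ∩ D), ih ?_⟩, fun S' => ⟨f ⁻¹' S', ih ?_⟩⟩
    · intro i hi x hx
      rcases Nat.lt_succ_iff_lt_or_eq.1 hi with hi | rfl
      · simpa [Function.update_of_ne hi.ne] using hQ i hi x hx
      · simp only [Function.update_self]
        refine ⟨fun h => ⟨x, ⟨h, hx⟩, rfl⟩, ?_⟩
        rintro ⟨y, ⟨hy, hyD⟩, hxy⟩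
        rwa [← hf.injOn hyD hx hxy]
    · intro i hi x hx
      rcases Nat.lt_succ_iff_lt_or_eq.1 hi with hi | rfl
      · simpa [Function.update_of_ne hi.ne] using hQ i hi x hx
      · simp

/-- Types only depend on the labels inside the domain. -/
theorem typ_congr (hQ : ∀ i < m, ∀ x ∈ D, x ∈ Q i ↔ x ∈ Q' i) : typ k m D Q = typ k m D Q' := by
  simpa using typ_image (f := id) (k := k) strictMonoOn_id hQ

/-- Composition: the type of an ordered sum is determined by the types of the summands. -/
theorem typ_iUnion {D D' : ℕ → Set ℕ} (hD : ∀ i j, i < j → ∀ x ∈ D i, ∀ y ∈ D j, x < y)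
    (hD' : ∀ i j, i < j → ∀ x ∈ D' i, ∀ y ∈ D' j, x < y)
    (h : ∀ i, typ k m (D i) Q = typ k m (D' i) Q') :
    typ k m (⋃ i, D i) Q = typ k m (⋃ i, D' i) Q' := by
  induction k generalizing m Q Q' with
  | zero =>
    have meets (E : ℕ → Set ℕ) (R : ℕ → Set ℕ) (i j : ℕ) :
        Meets (⋃ a, E a) R i j ↔ ∃ a, Meets (E a) R i j := by
      simp only [Meets, Set.mem_iUnion]
      grind
    have precedes (E : ℕ → Set ℕ) (R : ℕ → Set ℕ) (i j : ℕ)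
        (hE : ∀ a b, a < b → ∀ x ∈ E a, ∀ y ∈ E b, x < y) :
        Precedes (⋃ a, E a) R i j ↔ (∃ a, Precedes (E a) R i j) ∨
          ∃ a b, a < b ∧ Meets (E a) R i i ∧ Meets (E b) R j j := by
      simp only [Precedes, Meets, Set.mem_iUnion]
      constructor
      · rintro ⟨x, ⟨a, hx⟩, y, ⟨b, hy⟩, hxi, hyj, hxy⟩
        rcases lt_trichotomy a b with hab | rfl | hab
        · exact .inr ⟨a, b, hab, ⟨x, hx, hxi, hxi⟩, ⟨y, hy, hyj, hyj⟩⟩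
        · exact .inl ⟨a, x, hx, y, hy, hxi, hyj, hxy⟩
        · exact absurd (hE b a hab y hy x hx) hxy.not_gt
      · rintro (⟨a, x, hx, y, hy, hxi, hyj, hxy⟩ | ⟨a, b, hab, ⟨x, hx, hxi, -⟩, ⟨y, hy, hyj, -⟩⟩)
        · exact ⟨x, ⟨a, hx⟩, y, ⟨a, hy⟩, hxi, hyj, hxy⟩
        · exact ⟨x, ⟨a, hx⟩, y, ⟨b, hy⟩, hxi, hyj, hE a b hab x hx y hy⟩
    refine typ_zero_eq_iff.2 fun i hi j hj => ?_
    have h' := fun a => typ_zero_eq_iff.1 (h a)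
    rw [meets, meets, precedes _ _ _ _ hD, precedes _ _ _ _ hD']
    refine ⟨exists_congr fun a => (h' a i hi j hj).1, or_congr
      (exists_congr fun a => (h' a i hi j hj).2) (exists_congr fun a => exists_congr fun b => ?_)⟩
    rw [(h' a i hi i hi).1, (h' b j hj j hj).1]
  | succ k ih =>
    have glue {E : ℕ → Set ℕ} {R : ℕ → Set ℕ} (hE : ∀ a b, a < b → ∀ x ∈ E a, ∀ y ∈ E b, x < y)
        (S : ℕ → Set ℕ) (a : ℕ) : typ k (m + 1) (E a) (Function.update R m (S a)) =
          typ k (m + 1) (E a) (Function.update R m {x | ∃ b, x ∈ E b ∧ x ∈ S b}) := by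
      refine typ_congr fun i hi x hx => ?_
      rcases Nat.lt_succ_iff_lt_or_eq.1 hi with hi | rfl
      · simp [Function.update_of_ne hi.ne]
      · simp only [Function.update_self]
        refine ⟨fun h => ⟨a, hx, h⟩, ?_⟩
        rintro ⟨b, hb, hbS⟩
        rcases lt_trichotomy a b with hab | rfl | hab
        · exact absurd (hE a b hab x hx x hb) (lt_irrefl _)
        · exact hbS
        · exact absurd (hE b a hab x hb x hx) (lt_irrefl _)
    refine typ_succ_eq_iff.2 ⟨fun S => ?_, fun S' => ?_⟩
    · choose S' hS' using fun a => (typ_succ_eq_iff.1 (h a)).1 S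
      exact ⟨_, ih fun a => (hS' a).trans (glue hD' S' a)⟩
    · choose S hS using fun a => (typ_succ_eq_iff.1 (h a)).2 S'
      exact ⟨_, ih fun a => (glue hD S a).symm.trans (hS a)⟩

theorem typ_empty : typ k m ∅ Q = typ k m ∅ Q' := typ_congr (by simp)

/-- Composition for two adjacent intervals. -/
theorem typ_Ico_append {a b c a' b' c' : ℕ} (hab : a ≤ b) (hbc : b ≤ c) (hab' : a' ≤ b')
    (hbc' : b' ≤ c') (h₁ : typ k m (Set.Ico a b) Q = typ k m (Set.Ico a' b') Q')
    (h₂ : typ k m (Set.Ico b c) Q = typ k m (Set.Ico b' c') Q') :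
    typ k m (Set.Ico a c) Q = typ k m (Set.Ico a' c') Q' := by
  let F (a b c : ℕ) : ℕ → Set ℕ
    | 0 => Set.Ico a b
    | 1 => Set.Ico b c
    | _ => ∅
  have hF (a b c : ℕ) : ∀ i j, i < j → ∀ x ∈ F a b c i, ∀ y ∈ F a b c j, x < y := by
    rintro (_ | _ | i) (_ | _ | j) hij x hx y hy <;> simp [F] at hij hx hy
    omega
  have hU {a b c : ℕ} (hab : a ≤ b) (hbc : b ≤ c) : ⋃ i, F a b c i = Set.Ico a c := by
    ext x
    simp only [Set.mem_iUnion, Set.mem_Ico]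
    constructor
    · rintro ⟨_ | _ | i, hx⟩ <;> simp [F] at hx <;> omega
    · intro hx
      rcases lt_or_ge x b with h | h
      · exact ⟨0, hx.1, h⟩
      · exact ⟨1, h, hx.2⟩
  rw [← hU hab hbc, ← hU hab' hbc']
  refine typ_iUnion (hF _ _ _) (hF _ _ _) ?_
  rintro (_ | _ | i)
  · exact h₁
  · exact h₂
  · exact typ_empty

theorem StrictMono.exists_mem_Ico {g : ℕ → ℕ} (hg : StrictMono g) {x : ℕ} (hx : g 0 ≤ x) :
    ∃ i, x ∈ Set.Ico (g i) (g (i + 1)) := by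
  have hex : ∃ i, x < g (i + 1) := ⟨x, hg.id_le (x + 1)⟩
  refine ⟨Nat.find hex, ?_, Nat.find_spec hex⟩
  rcases Nat.eq_zero_or_pos (Nat.find hex) with h0 | h0
  · rwa [h0]
  · have := Nat.find_min hex (Nat.sub_one_lt h0.ne')
    rw [Nat.sub_add_cancel h0] at this
    omega

/-- Composition for a decomposition of `ℕ` into consecutive intervals. -/
theorem typ_univ_eq {g g' : ℕ → ℕ} (hg : StrictMono g) (hg' : StrictMono g')
    (h₀ : typ k m (Set.Ico 0 (g 0)) Q = typ k m (Set.Ico 0 (g' 0)) Q')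
    (h : ∀ i, typ k m (Set.Ico (g i) (g (i + 1))) Q = typ k m (Set.Ico (g' i) (g' (i + 1))) Q') :
    typ k m Set.univ Q = typ k m Set.univ Q' := by
  let F (g : ℕ → ℕ) : ℕ → Set ℕ
    | 0 => Set.Ico 0 (g 0)
    | i + 1 => Set.Ico (g i) (g (i + 1))
  have hF {g : ℕ → ℕ} (hg : StrictMono g) : ∀ i j, i < j → ∀ x ∈ F g i, ∀ y ∈ F g j, x < y := by
    rintro i (_ | j) hij x hx y hy
    · omega
    · have hy : g j ≤ y := hy.1
      have : x < g i := by cases i <;> exact hx.2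
      have := hg.monotone (show i ≤ j by omega)
      omega
  have hU {g : ℕ → ℕ} (hg : StrictMono g) : ⋃ i, F g i = Set.univ := by
    refine Set.eq_univ_of_forall fun x => Set.mem_iUnion.2 ?_
    rcases lt_or_ge x (g 0) with hx | hx
    · exact ⟨0, x.zero_le, hx⟩
    · obtain ⟨i, hi⟩ := StrictMono.exists_mem_Ico hg hx
      exact ⟨i + 1, hi⟩
  have key : typ k m (⋃ i, F g i) Q = typ k m (⋃ i, F g' i) Q' := by
    refine typ_iUnion (hF hg) (hF hg') ?_
    rintro (_ | i)
    · exact h₀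
    · exact h i
  rwa [hU hg, hU hg'] at key

/-- Types of intervals are invariant under translations. -/
theorem typ_Ico_add {a b : ℕ} (d : ℕ)
    (hQ : ∀ i < m, ∀ x ∈ Set.Ico a b, x ∈ Q i ↔ x + d ∈ Q' i) :
    typ k m (Set.Ico a b) Q = typ k m (Set.Ico (a + d) (b + d)) Q' := by
  rw [← Set.image_add_const_Ico]
  exact typ_image (fun _ _ _ _ h => Nat.add_lt_add_right h d) hQ

end typ

/-! ## Ramsey's theorem for pairs -/

theorem exists_homogeneous_subsequence {α : Type} [Finite α] {Y : Set ℕ} (hY : Y.Infinite)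
    (c : ℕ → ℕ → α) :
    ∃ f : ℕ → ℕ, StrictMono f ∧ (∀ i, f i ∈ Y) ∧ ∃ e, ∀ i j, i < j → c (f i) (f j) = e := by
  classical
  have hne : (Filter.cofinite ⊓ Filter.principal Y).NeBot :=
    Filter.cofinite_inf_principal_neBot_iff.2 hY
  let U : Ultrafilter ℕ := Ultrafilter.of (Filter.cofinite ⊓ Filter.principal Y)
  have hU : ↑U ≤ Filter.cofinite ⊓ Filter.principal Y := Ultrafilter.of_le _
  have hUY : ∀ᶠ y in U, y ∈ Y := hU (Filter.mem_inf_of_right (Filter.mem_principal_self Y))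
  have hUgt (x : ℕ) : ∀ᶠ y in U, x < y := by
    refine hU (Filter.mem_inf_of_left ?_)
    rw [Filter.mem_cofinite]
    exact (Set.finite_Iic x).subset fun y hy => by simpa using hy
  have lim (d : ℕ → α) : ∃ e, ∀ᶠ y in U, d y = e := by
    have : ∀ᶠ y in U, ∃ e, d y = e := .of_forall fun y => ⟨_, rfl⟩
    exact (U.eventually_exists_iff).1 this
  choose l hl using fun x => lim (c x)
  obtain ⟨e, he⟩ := lim l
  have step (s : Finset ℕ) : ∃ y, y ∈ Y ∧ l y = e ∧ ∀ x ∈ s, x < y ∧ c x y = l x :=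
    (hUY.and (he.and ((Filter.eventually_all_finset s).2
      fun x _ => (hUgt x).and (hl x)))).exists
  choose! g hgY hge hg using step
  let F : ℕ → Finset ℕ := fun i =>
    Nat.rec (motive := fun _ => Finset ℕ) ∅ (fun _ s => insert (g s) s) i
  have hF : ∀ i j, i < j → g (F i) ∈ F j := by
    intro i j hij
    induction j, hij using Nat.le_induction with
    | base => exact Finset.mem_insert_self _ _
    | succ j _ ih => exact Finset.mem_insert_of_mem ih
  exact ⟨fun i => g (F i), fun i j hij => (hg _ _ (hF i j hij)).1, fun i => hgY _, e,
    fun i j hij => (hg _ _ (hF i j hij)).2.trans (hge _)⟩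

/-! ## Types and satisfaction -/

section satisfaction

variable {n : ℕ}

/-- The structure `(A, r, P)` is embedded into `ℕ` along `ι`, the predicates being represented by
the first `n` labels of `Q`. -/
structure Represents {A : Type} (ι : A → ℕ) (r : A → A → Prop) (P : Fin n → Set A)
    (Q : ℕ → Set ℕ) : Prop where
  injective : Function.Injective ι
  rel : ∀ a b, r a b ↔ ι a < ι b
  pred : ∀ k a, a ∈ P k ↔ ι a ∈ Q k

theorem Represents.update {A : Type} {ι : A → ℕ} {r : A → A → Prop} {P : Fin n → Set A}
    {Q : ℕ → Set ℕ} (h : Represents ι r P Q) {m : ℕ} (hm : n ≤ m) (S : Set ℕ) :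
    Represents ι r P (Function.update Q m S) where
  injective := h.injective
  rel := h.rel
  pred k a := by
    rw [h.pred, Function.update_of_ne (by have := k.2; omega)]

theorem exists_singleton_of_typ_eq {A B : Type} {ι : A → ℕ} {κ : B → ℕ} {k m : ℕ}
    {Q Q' : ℕ → Set ℕ} {S S' : Set ℕ} (hκ : Function.Injective κ)
    (h : typ k (m + 1) (Set.range ι) (Function.update Q m S) =
      typ k (m + 1) (Set.range κ) (Function.update Q' m S'))
    {a : A} (ha : ∀ x, ι x ∈ S ↔ x = a) : ∃ b, ∀ y, κ y ∈ S' ↔ y = b := by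
  obtain ⟨h1, h2⟩ := typ_atoms (Nat.lt_succ_self m) (Nat.lt_succ_self m) h
  simp only [Meets, Precedes, Set.exists_range_iff, Function.update_self, and_self] at h1 h2
  obtain ⟨b, hb⟩ := h1.1 ⟨a, (ha a).2 rfl⟩
  refine ⟨b, fun y => ⟨fun hy => ?_, fun hy => hy ▸ hb⟩⟩
  have hno : ¬ ∃ y z, κ y ∈ S' ∧ κ z ∈ S' ∧ κ y < κ z := by
    rw [← h2]
    rintro ⟨y, z, hy, hz, hlt⟩
    rw [ha] at hy hz
    simp [hy, hz] at hlt
  refine hκ (le_antisymm ?_ ?_) <;> refine not_lt.1 fun hlt => hno ?_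
  · exact ⟨b, y, hb, hy, hlt⟩
  · exact ⟨y, b, hy, hb, hlt⟩

/-- Structures with the same type of depth `k` satisfy the same formulas of depth at most `k`. -/
theorem sat_iff_of_typ_eq {A B : Type} {ι : A → ℕ} {κ : B → ℕ} {r : A → A → Prop}
    {s : B → B → Prop} {P : Fin n → Set A} {P' : Fin n → Set B} (φ : MSO n) :
    ∀ {k m : ℕ} {Q Q' : ℕ → Set ℕ} {v : ℕ → A} {V : ℕ → Set A} {w : ℕ → B} {W : ℕ → Set B}
      {σ τ : ℕ → ℕ}, n ≤ m → Represents ι r P Q → Represents κ s P' Q' →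
      typ k m (Set.range ι) Q = typ k m (Set.range κ) Q' → φ.qd ≤ k →
      (∀ i ∈ φ.fv1, σ i < m ∧ (∀ a, ι a ∈ Q (σ i) ↔ a = v i) ∧
        ∀ b, κ b ∈ Q' (σ i) ↔ b = w i) →
      (∀ j ∈ φ.fv2, τ j < m ∧ (∀ a, a ∈ V j ↔ ι a ∈ Q (τ j)) ∧
        ∀ b, b ∈ W j ↔ κ b ∈ Q' (τ j)) →
      (φ.Sat r P v V ↔ φ.Sat s P' w W) := by
  induction φ with
  | lt i j =>
    intro k m Q Q' v V w W σ τ _ hQ hQ' h _ h1 _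
    obtain ⟨hi, hv, hw⟩ := h1 i (by simp [MSO.fv1])
    obtain ⟨hj, hv', hw'⟩ := h1 j (by simp [MSO.fv1])
    have := (typ_atoms hi hj h).2
    simpa [Precedes, hv, hv', hw, hw', MSO.Sat, hQ.rel, hQ'.rel] using this
  | pred p i =>
    intro k m Q Q' v V w W σ τ hm hQ hQ' h _ h1 _
    obtain ⟨hi, hv, hw⟩ := h1 i (by simp [MSO.fv1])
    have := (typ_atoms hi (lt_of_lt_of_le p.2 hm) h).1
    simpa [Meets, hv, hw, MSO.Sat, hQ.pred, hQ'.pred] using this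
  | mem i j =>
    intro k m Q Q' v V w W σ τ _ hQ hQ' h _ h1 h2
    obtain ⟨hi, hv, hw⟩ := h1 i (by simp [MSO.fv1])
    obtain ⟨hj, hV, hW⟩ := h2 j (by simp [MSO.fv2])
    have := (typ_atoms hi hj h).1
    simpa [Meets, hv, hw, MSO.Sat, hV, hW] using this
  | not φ ih =>
    intro k m Q Q' v V w W σ τ hm hQ hQ' h hk h1 h2
    exact not_congr (ih hm hQ hQ' h hk h1 h2)
  | and φ ψ ihφ ihψ =>
    intro k m Q Q' v V w W σ τ hm hQ hQ' h hk h1 h2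
    simp only [MSO.qd, max_le_iff] at hk
    simp only [MSO.fv1, MSO.fv2, Finset.mem_union] at h1 h2
    exact and_congr
      (ihφ hm hQ hQ' h hk.1 (fun i hi => h1 i (.inl hi)) fun j hj => h2 j (.inl hj))
      (ihψ hm hQ hQ' h hk.2 (fun i hi => h1 i (.inr hi)) fun j hj => h2 j (.inr hj))
  | ex1 i φ ih =>
    intro k m Q Q' v V w W σ τ hm hQ hQ' h hk h1 h2
    obtain _ | k := k
    · simp [MSO.qd] at hk
    have key (S S' : Set ℕ) (a : A) (b : B)
        (hS : typ k (m + 1) (Set.range ι) (Function.update Q m S) =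
          typ k (m + 1) (Set.range κ) (Function.update Q' m S'))
        (ha : ∀ x, ι x ∈ S ↔ x = a) (hb : ∀ y, κ y ∈ S' ↔ y = b) :
        φ.Sat r P (Function.update v i a) V ↔ φ.Sat s P' (Function.update w i b) W := by
      refine ih (σ := Function.update σ i m) (τ := τ) (by omega) (hQ.update hm S) (hQ'.update hm S')
        hS (by simpa [MSO.qd] using hk) (fun i' hi' => ?_) fun j hj => ?_
      · by_cases hii : i' = i
        · subst hii
          simpa using ⟨ha, hb⟩
        · obtain ⟨hlt, h⟩ := h1 i' (by simp [MSO.fv1, hi', hii])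
          simp only [Function.update_of_ne hii, Function.update_of_ne hlt.ne]
          exact ⟨by omega, h⟩
      · obtain ⟨hlt, h⟩ := h2 j hj
        simp only [Function.update_of_ne hlt.ne]
        exact ⟨by omega, h⟩
    have hbf := typ_succ_eq_iff.1 h
    constructor
    · rintro ⟨a, ha⟩
      have haS : ∀ x, ι x ∈ ({ι a} : Set ℕ) ↔ x = a := fun x => hQ.injective.eq_iff
      obtain ⟨S', hS'⟩ := hbf.1 {ι a}
      obtain ⟨b, hb⟩ := exists_singleton_of_typ_eq hQ'.injective hS' haS
      exact ⟨b, (key _ _ a b hS' haS hb).1 ha⟩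
    · rintro ⟨b, hb⟩
      have hbS : ∀ x, κ x ∈ ({κ b} : Set ℕ) ↔ x = b := fun x => hQ'.injective.eq_iff
      obtain ⟨S, hS⟩ := hbf.2 {κ b}
      obtain ⟨a, ha⟩ := exists_singleton_of_typ_eq hQ.injective hS.symm hbS
      exact ⟨a, (key _ _ a b hS ha hbS).2 hb⟩
  | ex2 j φ ih =>
    intro k m Q Q' v V w W σ τ hm hQ hQ' h hk h1 h2
    obtain _ | k := k
    · simp [MSO.qd] at hk
    have key (S S' : Set ℕ)
        (hS : typ k (m + 1) (Set.range ι) (Function.update Q m S) =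
          typ k (m + 1) (Set.range κ) (Function.update Q' m S'))
        (X : Set A) (Y : Set B) (hX : ∀ a, a ∈ X ↔ ι a ∈ S) (hY : ∀ b, b ∈ Y ↔ κ b ∈ S') :
        φ.Sat r P v (Function.update V j X) ↔ φ.Sat s P' w (Function.update W j Y) := by
      refine ih (σ := σ) (τ := Function.update τ j m) (by omega) (hQ.update hm S) (hQ'.update hm S')
        hS (by simpa [MSO.qd] using hk) (fun i hi => ?_) fun j' hj' => ?_
      · obtain ⟨hlt, h⟩ := h1 i hi
        simp only [Function.update_of_ne hlt.ne]
        exact ⟨by omega, h⟩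
      · by_cases hjj : j' = j
        · subst hjj
          simpa using ⟨hX, hY⟩
        · obtain ⟨hlt, h⟩ := h2 j' (by simp [MSO.fv2, hj', hjj])
          simp only [Function.update_of_ne hjj, Function.update_of_ne hlt.ne]
          exact ⟨by omega, h⟩
    have hbf := typ_succ_eq_iff.1 h
    constructor
    · rintro ⟨X, hX⟩
      obtain ⟨S', hS'⟩ := hbf.1 (ι '' X)
      exact ⟨κ ⁻¹' S', (key _ _ hS' X _
        (fun a => (hQ.injective.mem_set_image).symm) fun _ => Iff.rfl).1 hX⟩
    · rintro ⟨Y, hY⟩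
      obtain ⟨S, hS⟩ := hbf.2 (κ '' Y)
      exact ⟨ι ⁻¹' S, (key _ _ hS _ Y (fun _ => Iff.rfl)
        fun b => (hQ'.injective.mem_set_image).symm).2 hY⟩

/-- Satisfaction only depends on the values of the free variables. -/
theorem sat_congr {A : Type} {r : A → A → Prop} {P : Fin n → Set A} (φ : MSO n) :
    ∀ {v w : ℕ → A} {V W : ℕ → Set A}, (∀ i ∈ φ.fv1, v i = w i) → (∀ j ∈ φ.fv2, V j = W j) →
      (φ.Sat r P v V ↔ φ.Sat r P w W) := by
  induction φ with
  | lt i j =>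
    intro v w V W h1 h2
    simp [MSO.Sat, h1 i (by simp [MSO.fv1]), h1 j (by simp [MSO.fv1])]
  | pred p i => intro v w V W h1 h2; simp [MSO.Sat, h1 i (by simp [MSO.fv1])]
  | mem i j =>
    intro v w V W h1 h2
    simp [MSO.Sat, h1 i (by simp [MSO.fv1]), h2 j (by simp [MSO.fv2])]
  | not φ ih => intro v w V W h1 h2; exact not_congr (ih h1 h2)
  | and φ ψ ihφ ihψ =>
    intro v w V W h1 h2
    simp only [MSO.fv1, MSO.fv2, Finset.mem_union] at h1 h2
    exact and_congr (ihφ (fun i hi => h1 i (.inl hi)) fun j hj => h2 j (.inl hj))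
      (ihψ (fun i hi => h1 i (.inr hi)) fun j hj => h2 j (.inr hj))
  | ex1 i φ ih =>
    intro v w V W h1 h2
    refine exists_congr fun a => ih (fun i' hi' => ?_) h2
    by_cases hii : i' = i
    · simp [hii]
    · simpa [hii] using h1 i' (by simp [MSO.fv1, hi', hii])
  | ex2 j φ ih =>
    intro v w V W h1 h2
    refine exists_congr fun a => ih h1 fun j' hj' => ?_
    by_cases hjj : j' = j
    · simp [hjj]
    · simpa [hjj] using h2 j' (by simp [MSO.fv2, hj', hjj])

theorem trueIn_iff_sat {A : Type} {r : A → A → Prop} {P : Fin n → Set A} {φ : MSO n}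
    (hφ : φ.IsSentence) (v : ℕ → A) (V : ℕ → Set A) : φ.TrueIn r P ↔ φ.Sat r P v V :=
  ⟨fun h => h v V, fun h w W => (sat_congr φ (by simp [hφ.1]) (by simp [hφ.2])).1 h⟩

theorem trueIn_iff_of_typ_eq {A B : Type} [Nonempty A] [Nonempty B] {ι : A → ℕ} {κ : B → ℕ}
    {r : A → A → Prop} {s : B → B → Prop} {P : Fin n → Set A} {P' : Fin n → Set B}
    {Q Q' : ℕ → Set ℕ} {φ : MSO n} {k : ℕ} (hφ : φ.IsSentence) (hQ : Represents ι r P Q)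
    (hQ' : Represents κ s P' Q') (h : typ k n (Set.range ι) Q = typ k n (Set.range κ) Q')
    (hk : φ.qd ≤ k) : φ.TrueIn r P ↔ φ.TrueIn s P' := by
  rw [trueIn_iff_sat hφ (fun _ => Classical.arbitrary A) (fun _ => ∅),
    trueIn_iff_sat hφ (fun _ => Classical.arbitrary B) (fun _ => ∅)]
  exact sat_iff_of_typ_eq φ (σ := id) (τ := id) le_rfl hQ hQ' h hk (by simp [hφ.1])
    (by simp [hφ.2])

/-! ## Formulas describing types -/

namespace MSO

/-- Conjunction of a list of formulas. -/
def bigAnd : List (MSO n) → MSO n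
  | [] => .not (.ex1 0 (.lt 0 0))
  | φ :: l => .and φ (bigAnd l)

theorem sat_bigAnd {A : Type} {r : A → A → Prop} (hr : ∀ a, ¬ r a a) {P : Fin n → Set A}
    {v : ℕ → A} {V : ℕ → Set A} (l : List (MSO n)) :
    (bigAnd l).Sat r P v V ↔ ∀ φ ∈ l, φ.Sat r P v V := by
  induction l with
  | nil => simp [bigAnd, Sat, hr]
  | cons φ l ih => simp [bigAnd, Sat, ih]

theorem fv1_bigAnd {l : List (MSO n)} (h : ∀ φ ∈ l, φ.fv1 = ∅) : (bigAnd l).fv1 = ∅ := by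
  induction l with
  | nil => simp [bigAnd, fv1]
  | cons φ l ih =>
    simp only [List.mem_cons, forall_eq_or_imp] at h
    simp [bigAnd, fv1, h.1, ih h.2]

theorem fv2_bigAnd {l : List (MSO n)} {s : Finset ℕ} (h : ∀ φ ∈ l, φ.fv2 ⊆ s) :
    (bigAnd l).fv2 ⊆ s := by
  induction l with
  | nil => simp [bigAnd, fv2]
  | cons φ l ih =>
    simp only [List.mem_cons, forall_eq_or_imp] at h
    exact Finset.union_subset h.1 (ih h.2)

theorem qd_bigAnd {l : List (MSO n)} {d : ℕ} (hd : 1 ≤ d) (h : ∀ φ ∈ l, φ.qd ≤ d) :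
    (bigAnd l).qd ≤ d := by
  induction l with
  | nil => simpa [bigAnd, qd] using hd
  | cons φ l ih =>
    simp only [List.mem_cons, forall_eq_or_imp] at h
    exact max_le h.1 (ih h.2)

/-- The formula stating that the element `x` carries the `i`-th label, which is the `i`-th predicate
if `i < n` and is otherwise the value of the set variable `j`. -/
def label (x i j : ℕ) : MSO n :=
  if h : i < n then .pred ⟨i, h⟩ x else .mem x j

theorem fv1_label (x i j : ℕ) : (label x i j : MSO n).fv1 = {x} := by
  unfold label; split <;> simp [fv1]

theorem fv2_label {x i j : ℕ} : (label x i j : MSO n).fv2 = if i < n then ∅ else {j} := by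
  unfold label; split <;> simp [fv2, *]

theorem qd_label (x i j : ℕ) : (label x i j : MSO n).qd = 0 := by
  unfold label; split <;> simp [qd]

/-- The formula stating that the labels `i` and `j` meet. -/
def meets (i j : ℕ) : MSO n := .ex1 0 (.and (label 0 i i) (label 0 j j))

/-- The formula stating that an element with label `i` precedes an element with label `j`. -/
def precedes (i j : ℕ) : MSO n :=
  .ex1 0 (.ex1 1 (.and (label 0 i i) (.and (label 1 j j) (.lt 0 1))))

end MSO

theorem sat_label {A : Type} {ι : A → ℕ} {r : A → A → Prop} {P : Fin n → Set A} {Q : ℕ → Set ℕ}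
    (hQ : Represents ι r P Q) {v : ℕ → A} {V : ℕ → Set A} {i j : ℕ} (x : ℕ)
    (hV : n ≤ i → ∀ a, a ∈ V j ↔ ι a ∈ Q i) :
    (MSO.label x i j).Sat r P v V ↔ ι (v x) ∈ Q i := by
  unfold MSO.label
  split
  · exact hQ.pred _ _
  · exact hV (by omega) _

/-- Every type of depth `k` is described by a formula of depth at most `k + 2`. -/
theorem exists_formula_typ_eq (k : ℕ) : ∀ {m : ℕ}, n ≤ m → ∀ t : Ty k m, ∃ χ : MSO n,
    χ.fv1 = ∅ ∧ χ.fv2 ⊆ Finset.Ico n m ∧ χ.qd ≤ k + 2 ∧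
    ∀ {A : Type} {ι : A → ℕ} {r : A → A → Prop} {P : Fin n → Set A} {Q : ℕ → Set ℕ}
      {v : ℕ → A} {V : ℕ → Set A}, Represents ι r P Q →
      (∀ j, n ≤ j → j < m → ∀ a, a ∈ V j ↔ ι a ∈ Q j) →
      (χ.Sat r P v V ↔ typ k m (Set.range ι) Q = t) := by
  classical
  induction k with
  | zero =>
    rintro m hm ⟨t₁, t₂⟩
    let lit (b : Prop) (φ : MSO n) : MSO n := if b then φ else .not φ
    have lit_fv1 (b : Prop) (φ : MSO n) : (lit b φ).fv1 = φ.fv1 := by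
      simp only [lit]; split <;> rfl
    have lit_fv2 (b : Prop) (φ : MSO n) : (lit b φ).fv2 = φ.fv2 := by
      simp only [lit]; split <;> rfl
    have lit_qd (b : Prop) (φ : MSO n) : (lit b φ).qd = φ.qd := by
      simp only [lit]; split <;> rfl
    have lit_sat {A : Type} {r : A → A → Prop} {P : Fin n → Set A} {v : ℕ → A} {V : ℕ → Set A}
        (b : Prop) (φ : MSO n) : (lit b φ).Sat r P v V ↔ (φ.Sat r P v V ↔ b) := by
      by_cases hb : b <;> simp [lit, hb, MSO.Sat]
    have label_fv2 (x : ℕ) (i : Fin m) : (MSO.label x i i : MSO n).fv2 ⊆ Finset.Ico n m := by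
      rw [MSO.fv2_label]
      split <;> simp <;> omega
    let l (ij : Fin m × Fin m) : MSO n :=
      .and (lit (ij ∈ t₁) (MSO.meets ij.1 ij.2)) (lit (ij ∈ t₂) (MSO.precedes ij.1 ij.2))
    have hl {φ : MSO n} (h : φ ∈ (Finset.univ.toList.map l)) : ∃ ij, φ = l ij := by
      obtain ⟨ij, -, rfl⟩ := List.mem_map.1 h
      exact ⟨ij, rfl⟩
    refine ⟨MSO.bigAnd (Finset.univ.toList.map l), MSO.fv1_bigAnd fun φ hφ => ?_,
      MSO.fv2_bigAnd fun φ hφ => ?_, MSO.qd_bigAnd (by omega) fun φ hφ => ?_, ?_⟩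
    · obtain ⟨ij, rfl⟩ := hl hφ
      simp only [l, MSO.fv1, lit_fv1, MSO.meets, MSO.precedes, MSO.fv1_label]
      ext x
      simp
    · obtain ⟨ij, rfl⟩ := hl hφ
      simp only [l, MSO.fv2, lit_fv2, MSO.meets, MSO.precedes, Finset.union_subset_iff,
        label_fv2, Finset.empty_subset, and_self]
    · obtain ⟨ij, rfl⟩ := hl hφ
      simp [l, MSO.qd, lit_qd, MSO.meets, MSO.precedes, MSO.qd_label]
    · intro A ι r P Q v V hQ hV
      rw [MSO.sat_bigAnd (fun a => by simp [hQ.rel])]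
      have hlabel (w : ℕ → A) (x : ℕ) (i : Fin m) :
          (MSO.label x i i).Sat r P w V ↔ ι (w x) ∈ Q i :=
        sat_label hQ x fun hi => hV i hi i.2
      have hsat (ij : Fin m × Fin m) : (l ij).Sat r P v V ↔
          (Meets (Set.range ι) Q ij.1 ij.2 ↔ ij ∈ t₁) ∧
            (Precedes (Set.range ι) Q ij.1 ij.2 ↔ ij ∈ t₂) := by
        simp [l, MSO.Sat, lit_sat, MSO.meets, MSO.precedes, hlabel, Meets, Precedes, hQ.rel]
      simp only [List.mem_map, Finset.mem_toList, Finset.mem_univ, true_and, forall_exists_index,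
        forall_apply_eq_imp_iff, hsat]
      change _ ↔ (({ij | Meets _ Q ij.1 ij.2}, {ij | Precedes _ Q ij.1 ij.2}) :
        Set (Fin m × Fin m) × Set (Fin m × Fin m)) = (t₁, t₂)
      rw [Prod.mk.injEq, Set.ext_iff, Set.ext_iff, ← forall_and]
      rfl
  | succ k ih =>
    intro m hm t
    choose χ hχ1 hχ2 hχd hχ using @ih (m + 1) (by omega)
    change Set (Ty k (m + 1)) at t
    have : Fintype (Ty k (m + 1)) := Fintype.ofFinite _
    let T := (Finset.univ.filter (· ∈ t)).toList
    have hT (s : Ty k (m + 1)) : s ∈ T ↔ s ∈ t := by simp [T]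
    have hfv2 (s : Ty k (m + 1)) : (χ s).fv2 \ {m} ⊆ Finset.Ico n m := by
      intro j hj
      have := hχ2 s (Finset.mem_sdiff.1 hj).1
      simp at hj this ⊢
      omega
    refine ⟨.and (MSO.bigAnd (T.map fun s => .ex2 m (χ s)))
      (.not (.ex2 m (MSO.bigAnd (T.map fun s => .not (χ s))))), ?_, ?_, ?_, ?_⟩
    · simp only [MSO.fv1, Finset.union_eq_empty]
      constructor <;> refine MSO.fv1_bigAnd fun φ hφ => ?_ <;>
        obtain ⟨s, -, rfl⟩ := List.mem_map.1 hφ <;> exact hχ1 s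
    · simp only [MSO.fv2, Finset.union_subset_iff]
      constructor
      · refine MSO.fv2_bigAnd fun φ hφ => ?_
        obtain ⟨s, -, rfl⟩ := List.mem_map.1 hφ
        exact hfv2 s
      · intro j hj
        rw [Finset.mem_sdiff] at hj
        have := MSO.fv2_bigAnd (s := Finset.Ico n (m + 1)) (fun φ hφ => ?_) hj.1
        · simp at hj this ⊢
          omega
        · obtain ⟨s, -, rfl⟩ := List.mem_map.1 hφ
          exact hχ2 s
    · simp only [MSO.qd, max_le_iff]
      constructor
      · refine MSO.qd_bigAnd (by omega) fun φ hφ => ?_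
        obtain ⟨s, -, rfl⟩ := List.mem_map.1 hφ
        have := hχd s
        simp only [MSO.qd]
        omega
      · have := MSO.qd_bigAnd (l := T.map fun s => .not (χ s)) (d := k + 2) (by omega)
          fun φ hφ => by
            obtain ⟨s, -, rfl⟩ := List.mem_map.1 hφ
            exact hχd s
        omega
    · intro A ι r P Q v V hQ hV
      have hr : ∀ a, ¬ r a a := fun a => by simp [hQ.rel]
      have key (S : Set ℕ) (X : Set A) (hX : ∀ a, a ∈ X ↔ ι a ∈ S) (s : Ty k (m + 1)) :
          (χ s).Sat r P v (Function.update V m X) ↔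
            typ k (m + 1) (Set.range ι) (Function.update Q m S) = s := by
        refine hχ s (hQ.update hm S) fun j hj hjm a => ?_
        rcases Nat.lt_succ_iff_lt_or_eq.1 hjm with hjm | rfl
        · simpa [Function.update_of_ne hjm.ne] using hV j hj hjm a
        · simpa using hX a
      have himage (X : Set A) : ∀ a, a ∈ X ↔ ι a ∈ ι '' X :=
        fun a => (hQ.injective.mem_set_image).symm
      simp only [MSO.Sat, MSO.sat_bigAnd hr, List.mem_map, forall_exists_index, and_imp,
        forall_apply_eq_imp_iff₂, hT]
      change _ ↔ (Set.range _ : Set (Ty k (m + 1))) = t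
      constructor
      · rintro ⟨h1, h2⟩
        apply Set.Subset.antisymm
        · rintro _ ⟨S, rfl⟩
          by_contra hS
          refine h2 ⟨ι ⁻¹' S, fun s hs hsat => hS ?_⟩
          obtain rfl := (key S (ι ⁻¹' S) (fun _ => Iff.rfl) s).1 hsat
          exact hs
        · intro s hs
          obtain ⟨X, hX⟩ := h1 s hs
          exact ⟨ι '' X, (key _ X (himage X) s).1 hX⟩
      · rintro rfl
        constructor
        · rintro _ ⟨S, rfl⟩
          exact ⟨ι ⁻¹' S, (key S _ (fun _ => Iff.rfl) _).2 rfl⟩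
        · rintro ⟨X, hX⟩
          exact hX _ ⟨ι '' X, rfl⟩ ((key _ X (himage X) _).2 rfl)

/-- Structures satisfying the same sentences of depth `k + 2` have the same type of depth `k`. -/
theorem typ_eq_of_equivType {A B : Type} [Nonempty A] [Nonempty B] {ι : A → ℕ} {κ : B → ℕ}
    {r : A → A → Prop} {s : B → B → Prop} {P : Fin n → Set A} {P' : Fin n → Set B}
    {Q Q' : ℕ → Set ℕ} {k : ℕ} (hQ : Represents ι r P Q) (hQ' : Represents κ s P' Q')
    (h : MSO.EquivType (k + 2) r P s P') :
    typ k n (Set.range ι) Q = typ k n (Set.range κ) Q' := by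
  obtain ⟨χ, h1, h2, hd, hχ⟩ := exists_formula_typ_eq k (le_refl n) (typ k n (Set.range κ) Q')
  have hsent : χ.IsSentence := ⟨h1, by simpa using h2⟩
  have := h χ hsent hd
  rw [trueIn_iff_sat hsent (fun _ => Classical.arbitrary A) (fun _ => ∅),
    trueIn_iff_sat hsent (fun _ => Classical.arbitrary B) (fun _ => ∅),
    hχ hQ (by omega), hχ hQ' (by omega)] at this
  exact this.2 rfl

end satisfaction

/-! ## Ultimately periodic witnesses -/

section periodic

/-- From `p` on, the set `S` is periodic with period `q`. -/
def PeriodicFrom (p q : ℕ) (S : Set ℕ) : Prop := ∀ x, p ≤ x → (x ∈ S ↔ x + q ∈ S)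

theorem PeriodicFrom.mul {p q : ℕ} {S : Set ℕ} (h : PeriodicFrom p q S) (i : ℕ) :
    PeriodicFrom p (i * q) S := by
  induction i with
  | zero => intro x _; simp
  | succ i ih =>
    intro x hx
    rw [ih x hx, h _ (by omega), Nat.succ_mul, add_assoc]

theorem PeriodicFrom.mono {p p' q : ℕ} {S : Set ℕ} (h : PeriodicFrom p q S) (hp : p ≤ p') :
    PeriodicFrom p' q S := fun x hx => h x (hp.trans hx)

theorem update_mem_iff {Q Q' : ℕ → Set ℕ} {S S' : Set ℕ} {m x y : ℕ}
    (hQ : ∀ i < m, x ∈ Q i ↔ y ∈ Q' i) (hS : x ∈ S ↔ y ∈ S') :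
    ∀ i < m + 1, x ∈ Function.update Q m S i ↔ y ∈ Function.update Q' m S' i := by
  intro i hi
  rcases Nat.lt_succ_iff_lt_or_eq.1 hi with hi | rfl
  · simpa [Function.update_of_ne hi.ne] using hQ i hi
  · simpa using hS

variable {k m p q N : ℕ} {Q : ℕ → Set ℕ}

theorem exists_typ_Ico_eq (hN : Nat.card (Ty k (m + 1)) ≤ N)
    (hQ : ∀ i < m, PeriodicFrom p q (Q i)) {o : ℕ} (ho : o ≤ p) (a : ℕ) :
    ∀ S : Set ℕ, 1 ≤ a → ∃ a' S', 1 ≤ a' ∧ a' ≤ N ∧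
      typ k (m + 1) (Set.Ico o (p + a * q)) (Function.update Q m S) =
        typ k (m + 1) (Set.Ico o (p + a' * q)) (Function.update Q m S') := by
  induction a using Nat.strong_induction_on with
  | _ a ih =>
    intro S ha
    by_cases haN : a ≤ N
    · exact ⟨a, S, ha, haN, rfl⟩
    let c (i : Fin a) : Ty k (m + 1) :=
      typ k (m + 1) (Set.Ico o (p + (i + 1) * q)) (Function.update Q m S)
    have hc : ¬ Function.Injective c := fun hinj => by
      have := Nat.card_le_card_of_injective c hinj
      simp at this
      omega
    obtain ⟨i, j, hij, hlt⟩ : ∃ i j : Fin a, c i = c j ∧ i < j := by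
      simp only [Function.Injective, not_forall] at hc
      obtain ⟨i, j, hij, hne⟩ := hc
      rcases lt_or_gt_of_ne hne with h | h
      · exact ⟨i, j, hij, h⟩
      · exact ⟨j, i, hij.symm, h⟩
    obtain ⟨i, hi⟩ := i
    obtain ⟨j, hj⟩ := j
    obtain ⟨d, rfl⟩ := Nat.exists_eq_add_of_lt (show i < j from hlt)
    obtain ⟨e, rfl⟩ := Nat.exists_eq_add_of_lt hj
    simp only [c] at hij
    let S' : Set ℕ := {x | if x < p + (i + 1) * q then x ∈ S else x + (d + 1) * q ∈ S}
    have hS' : typ k (m + 1) (Set.Ico o (p + (i + d + 1 + e + 1) * q)) (Function.update Q m S) =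
        typ k (m + 1) (Set.Ico o (p + (i + 1 + e) * q)) (Function.update Q m S') := by
      symm
      refine typ_Ico_append (b := p + (i + 1) * q) (b' := p + (i + d + 1 + 1) * q)
        (by omega) ?_ (by omega) ?_ (.trans (typ_congr ?_) hij) ?_
      · exact Nat.add_le_add_left (Nat.mul_le_mul_right q (by omega)) p
      · exact Nat.add_le_add_left (Nat.mul_le_mul_right q (by omega)) p
      · intro l hl x hx
        exact update_mem_iff (fun _ _ => Iff.rfl) (by simp [S', hx.2]) l hl
      · convert typ_Ico_add ((d + 1) * q) (Q' := Function.update Q m S) ?_ using 2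
        · congr 1 <;> ring
        · intro l hl x hx
          refine update_mem_iff (fun t ht => (hQ t ht).mul _ x ?_) ?_ l hl
          · exact le_trans (by omega) hx.1
          · simp [S', not_lt.2 hx.1]
    obtain ⟨a', S'', h1, h2, h3⟩ := ih (i + 1 + e) (by omega) S' (by omega)
    exact ⟨a', S'', h1, h2, hS'.trans h3⟩

/-- Over an ultimately periodic labelling, every further label may be replaced by an ultimately
periodic one, with a bound on the new period, without changing the type. -/
theorem exists_periodic_typ_eq (hN : Nat.card (Ty k (m + 1)) ≤ N) (hq : 0 < q)
    (hQ : ∀ i < m, PeriodicFrom p q (Q i)) (S : Set ℕ) :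
    ∃ p' q' S', p' ≤ p + N * q ∧ 0 < q' ∧ q' ≤ N * q ∧ PeriodicFrom p' q' S' ∧
      typ k (m + 1) Set.univ (Function.update Q m S) =
        typ k (m + 1) Set.univ (Function.update Q m S') := by
  obtain ⟨f, hf, hf1, e, he⟩ := exists_homogeneous_subsequence (Set.Ici_infinite 1)
    (fun i j => typ k (m + 1) (Set.Ico (p + i * q) (p + j * q)) (Function.update Q m S))
  simp only [Set.mem_Ici] at hf1
  obtain ⟨a, S₁, ha, haN, hS₁⟩ := exists_typ_Ico_eq hN hQ (Nat.zero_le p) (f 0) S (hf1 0)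
  have h01 : f 0 < f 1 := hf (by simp)
  obtain ⟨d, hd⟩ := Nat.exists_eq_add_of_lt h01
  obtain ⟨b, S₂, hb, hbN, hS₂⟩ := exists_typ_Ico_eq hN hQ (le_refl p) (d + 1)
    {x | x + f 0 * q ∈ S} (by omega)
  have hS₂e : typ k (m + 1) (Set.Ico p (p + b * q)) (Function.update Q m S₂) = e := by
    refine hS₂.symm.trans (.trans (typ_Ico_add (f 0 * q) (Q' := Function.update Q m S) ?_)
      (.trans ?_ (he 0 1 (by simp))))
    · intro l hl x hx
      exact update_mem_iff (fun t ht => (hQ t ht).mul _ x hx.1) (by simp) l hl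
    · rw [hd, show p + (d + 1) * q + f 0 * q = p + (f 0 + d + 1) * q by ring]
  have hbq : 0 < b * q := Nat.mul_pos hb hq
  let S' : Set ℕ :=
    {x | if x < p + a * q then x ∈ S₁ else p + (x - (p + a * q)) % (b * q) ∈ S₂}
  refine ⟨p + a * q, b * q, S', by gcongr, hbq, by gcongr, fun x hx => ?_, ?_⟩
  · have h1 : ¬ x < p + a * q := by omega
    have h2 : ¬ x + b * q < p + a * q := by omega
    have h3 : x + b * q - (p + a * q) = x - (p + a * q) + b * q := by omega
    simp [S', h1, h2, h3]
  · refine typ_univ_eq (g := fun i => p + f i * q) (g' := fun i => p + a * q + i * (b * q))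
      (fun i j hij => ?_) (fun i j hij => ?_) ?_ fun i => ?_
    · have := Nat.mul_lt_mul_of_pos_right (hf hij) hq
      simpa using this
    · have := Nat.mul_lt_mul_of_pos_right hij hbq
      simpa using this
    · refine hS₁.trans ?_
      simp only [zero_mul, add_zero]
      refine typ_congr fun l hl x hx => update_mem_iff (fun _ _ => Iff.rfl) ?_ l hl
      simp [S', hx.2]
    · refine (he i (i + 1) (by omega)).trans (hS₂e.symm.trans ?_)
      convert typ_Ico_add (a * q + i * (b * q)) (Q' := Function.update Q m S') ?_ using 2
      · congr 1 <;> ring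
      · intro l hl x hx
        refine update_mem_iff (fun t ht => ?_) ?_ l hl
        · have := (hQ t ht).mul (a + i * b) x hx.1
          rwa [show (a + i * b) * q = a * q + i * (b * q) by ring] at this
        · have h1 : ¬ x + (a * q + i * (b * q)) < p + a * q := by
            have := hx.1
            omega
          have h2 : x + (a * q + i * (b * q)) - (p + a * q) = x - p + i * (b * q) := by
            have := hx.1
            omega
          have h3 : x - p < b * q := by
            have := hx.2
            omega
          have h4 : p + (x - p) = x := by
            have := hx.1
            omega
          simp only [Set.mem_ofPred_eq, h1, if_false, h2, Nat.add_mul_mod_self_right, S',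
            Nat.mod_eq_of_lt h3, h4]

end periodic

/-! ## Codes of ultimately periodic sets -/

section lasso

/-- The number whose `i`-th binary digit is `b i` for `i < L`. -/
def bitMask (b : ℕ → Bool) (L : ℕ) : ℕ :=
  L.rec 0 fun i m => bif b i then 2 ^ i + m else m

theorem bitMask_lt (b : ℕ → Bool) (L : ℕ) : bitMask b L < 2 ^ L := by
  induction L with
  | zero => simp [bitMask]
  | succ L ih =>
    rw [pow_succ]
    change (bif b L then 2 ^ L + bitMask b L else bitMask b L) < _
    cases b L <;> simp <;> omega

theorem testBit_bitMask (b : ℕ → Bool) {L i : ℕ} (hi : i < L) : (bitMask b L).testBit i = b i := by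
  induction L with
  | zero => omega
  | succ L ih =>
    change (bif b L then 2 ^ L + bitMask b L else bitMask b L).testBit i = _
    rcases Nat.lt_succ_iff_lt_or_eq.1 hi with hi | rfl
    · cases b L <;> simp [Nat.testBit_two_pow_add_gt hi, ih hi]
    · have := Nat.testBit_lt_two_pow (bitMask_lt b i)
      cases hb : b i <;> simp [Nat.testBit_two_pow_add_eq, this]

/-- The characteristic function of the ultimately periodic set coded by `s`. -/
def lassoBit (s x : ℕ) : Bool :=
  s.unpair.2.unpair.2.testBit
    (if x < s.unpair.1 then x else s.unpair.1 + (x - s.unpair.1) % (s.unpair.2.unpair.1 + 1))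

/-- The ultimately periodic set coded by `s`. -/
def lassoSet (s : ℕ) : Set ℕ := {x | lassoBit s x = true}

theorem periodicFrom_lassoSet (s : ℕ) :
    PeriodicFrom s.unpair.1 (s.unpair.2.unpair.1 + 1) (lassoSet s) := by
  intro x hx
  have h1 : ¬ x < s.unpair.1 := by omega
  have h2 : ¬ x + (s.unpair.2.unpair.1 + 1) < s.unpair.1 := by omega
  have h3 : x + (s.unpair.2.unpair.1 + 1) - s.unpair.1 =
    x - s.unpair.1 + (s.unpair.2.unpair.1 + 1) := by omega
  simp only [lassoSet, lassoBit, Set.mem_ofPred_eq, h1, h2, if_false, h3, Nat.add_mod_right]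

/-- Every number above the components of `s` may serve as a preperiod, and the factorial of its
successor as a period. -/
theorem periodicFrom_lassoSet_factorial {s w : ℕ} (h : s ≤ w) :
    PeriodicFrom (w + 1) (w + 1).factorial (lassoSet s) := by
  have h2 := s.unpair_right_le
  have h3 := s.unpair.2.unpair_left_le
  obtain ⟨d, hd⟩ := Nat.dvd_factorial (m := s.unpair.2.unpair.1 + 1) (n := w + 1)
    (by omega) (by omega)
  rw [hd, mul_comm]
  exact ((periodicFrom_lassoSet s).mul d).mono (by have := s.unpair_left_le; omega)

/-- The code of the set with preperiod `p`, period `q + 1` and characteristic function `b`. -/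
def lassoCode (b : ℕ → Bool) (p q : ℕ) : ℕ := Nat.pair p (Nat.pair q (bitMask b (p + q + 1)))

theorem lassoBit_lassoCode (b : ℕ → Bool) (p q x : ℕ) :
    lassoBit (lassoCode b p q) x = b (if x < p then x else p + (x - p) % (q + 1)) := by
  simp only [lassoBit, lassoCode, Nat.unpair_pair]
  refine testBit_bitMask b ?_
  split_ifs
  · omega
  · have : (x - p) % (q + 1) < q + 1 := Nat.mod_lt _ (Nat.succ_pos q)
    omega

/-- An upper bound on the codes of sets whose preperiod and period are at most `a`. -/
def lassoBound (a : ℕ) : ℕ := Nat.pair a (Nat.pair a (2 ^ (a + a)))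

theorem pair_le_pair {a b c d : ℕ} (h₁ : a ≤ c) (h₂ : b ≤ d) : Nat.pair a b ≤ Nat.pair c d := by
  rcases h₁.lt_or_eq with h₁ | rfl <;> rcases h₂.lt_or_eq with h₂ | rfl
  · exact ((Nat.pair_lt_pair_left b h₁).trans (Nat.pair_lt_pair_right c h₂)).le
  · exact (Nat.pair_lt_pair_left b h₁).le
  · exact (Nat.pair_lt_pair_right a h₂).le
  · exact le_rfl

theorem exists_lassoSet_eq {p q a : ℕ} {S : Set ℕ} (hS : PeriodicFrom p q S) (hq : 0 < q)
    (hp : p ≤ a) (hqa : q ≤ a) : ∃ s ≤ lassoBound a, lassoSet s = S := by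
  classical
  obtain ⟨q, rfl⟩ := Nat.exists_eq_succ_of_ne_zero hq.ne'
  refine ⟨lassoCode (fun x => decide (x ∈ S)) p q,
    pair_le_pair hp (pair_le_pair (by omega) ((bitMask_lt _ _).le.trans
      (Nat.pow_le_pow_right (by norm_num) (by omega)))), ?_⟩
  ext x
  simp only [lassoSet, Set.mem_ofPred_eq, lassoBit_lassoCode, decide_eq_true_eq]
  split_ifs with hx
  · rfl
  · rw [hS.mul ((x - p) / (q + 1)) _ (by omega), Nat.succ_eq_add_one]
    have := Nat.mod_add_div' (x - p) (q + 1)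
    rw [show p + (x - p) % (q + 1) + (x - p) / (q + 1) * (q + 1) = x by omega]

end lasso

/-! ## Decoding formulas -/

section decoding

variable {n : ℕ}

namespace MSO

theorem snd_unpair_lt {c : ℕ} (h : 0 < c.unpair.1) : c.unpair.2 < c := by
  have := Nat.add_le_pair c.unpair.1 c.unpair.2
  rw [Nat.pair_unpair] at this
  omega

/-- The formula with code `c`; numbers which are no codes are mapped to junk values. -/
def ofCode (n : ℕ) (c : ℕ) : MSO n :=
  if c.unpair.1 = 1 then
    if h : c.unpair.2.unpair.1 < n then .pred ⟨_, h⟩ c.unpair.2.unpair.2 else .lt 0 0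
  else if c.unpair.1 = 2 then .mem c.unpair.2.unpair.1 c.unpair.2.unpair.2
  else if h : c.unpair.1 = 3 then
    have := snd_unpair_lt (c := c) (by omega)
    .not (ofCode n c.unpair.2)
  else if h : c.unpair.1 = 4 then
    have := snd_unpair_lt (c := c) (by omega)
    have := c.unpair.2.unpair_left_le
    have := c.unpair.2.unpair_right_le
    .and (ofCode n c.unpair.2.unpair.1) (ofCode n c.unpair.2.unpair.2)
  else if h : c.unpair.1 = 5 then
    have := snd_unpair_lt (c := c) (by omega)
    have := c.unpair.2.unpair_right_le
    .ex1 c.unpair.2.unpair.1 (ofCode n c.unpair.2.unpair.2)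
  else if h : c.unpair.1 = 6 then
    have := snd_unpair_lt (c := c) (by omega)
    have := c.unpair.2.unpair_right_le
    .ex2 c.unpair.2.unpair.1 (ofCode n c.unpair.2.unpair.2)
  else if c.unpair.1 = 0 then .lt c.unpair.2.unpair.1 c.unpair.2.unpair.2
  else .lt 0 0
termination_by c
decreasing_by all_goals omega

theorem ofCode_encode (φ : MSO n) : ofCode n φ.encode = φ := by
  induction φ with
  | _ => rw [ofCode]; simp [encode, *]

section ofCode

variable {c : ℕ}

theorem ofCode_not (h : c.unpair.1 = 3) : ofCode n c = .not (ofCode n c.unpair.2) := by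
  rw [ofCode]; simp [h]

theorem ofCode_and (h : c.unpair.1 = 4) :
    ofCode n c = .and (ofCode n c.unpair.2.unpair.1) (ofCode n c.unpair.2.unpair.2) := by
  rw [ofCode]; simp [h]

theorem ofCode_ex1 (h : c.unpair.1 = 5) :
    ofCode n c = .ex1 c.unpair.2.unpair.1 (ofCode n c.unpair.2.unpair.2) := by
  rw [ofCode]; simp [h]

theorem ofCode_ex2 (h : c.unpair.1 = 6) :
    ofCode n c = .ex2 c.unpair.2.unpair.1 (ofCode n c.unpair.2.unpair.2) := by
  rw [ofCode]; simp [h]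

end ofCode

/-- Induction along the decoding of formulas. -/
theorem ofCode_induction {p : ℕ → Prop}
    (atom : ∀ c, c.unpair.1 ≤ 2 ∨ 7 ≤ c.unpair.1 → p c)
    (not : ∀ c, c.unpair.1 = 3 → p c.unpair.2 → p c)
    (and : ∀ c, c.unpair.1 = 4 → p c.unpair.2.unpair.1 → p c.unpair.2.unpair.2 → p c)
    (ex : ∀ c, c.unpair.1 = 5 ∨ c.unpair.1 = 6 → p c.unpair.2.unpair.2 → p c) (c : ℕ) : p c := by
  induction c using Nat.strong_induction_on with
  | _ c ih =>
    have h1 := c.unpair.2.unpair_left_le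
    have h2 := c.unpair.2.unpair_right_le
    by_cases h : c.unpair.1 ≤ 2 ∨ 7 ≤ c.unpair.1
    · exact atom c h
    have h0 := snd_unpair_lt (c := c) (by omega)
    obtain h | h | h : c.unpair.1 = 3 ∨ c.unpair.1 = 4 ∨ (c.unpair.1 = 5 ∨ c.unpair.1 = 6) := by
      omega
    · exact not c h (ih _ h0)
    · exact and c h (ih _ (by omega)) (ih _ (by omega))
    · exact ex c h (ih _ (by omega))

theorem ofCode_bounds (c : ℕ) :
    (ofCode n c).qd ≤ c ∧ (∀ i ∈ (ofCode n c).fv1, i ≤ c) ∧ ∀ j ∈ (ofCode n c).fv2, j ≤ c := by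
  have hr (c : ℕ) := c.unpair_right_le
  have hl (c : ℕ) := c.unpair.2.unpair_left_le
  have hr' (c : ℕ) := c.unpair.2.unpair_right_le
  induction c using ofCode_induction with
  | atom c h =>
    have h1 := hr c
    have h2 := hl c
    have h3 := hr' c
    rw [ofCode]
    split_ifs <;> simp [qd, fv1, fv2] <;> omega
  | not c h ih =>
    have h1 := hr c
    rw [ofCode_not h]
    exact ⟨ih.1.trans h1, fun i hi => (ih.2.1 i hi).trans h1, fun i hi => (ih.2.2 i hi).trans h1⟩
  | and c h ih₁ ih₂ =>
    have h1 := (hl c).trans (hr c)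
    have h2 := (hr' c).trans (hr c)
    simp only [ofCode_and h, qd, fv1, fv2, Finset.mem_union]
    exact ⟨max_le (ih₁.1.trans h1) (ih₂.1.trans h2),
      fun i hi => hi.elim (fun hi => (ih₁.2.1 i hi).trans h1) fun hi => (ih₂.2.1 i hi).trans h2,
      fun i hi => hi.elim (fun hi => (ih₁.2.2 i hi).trans h1) fun hi => (ih₂.2.2 i hi).trans h2⟩
  | ex c h ih =>
    have h0 := snd_unpair_lt (c := c) (by omega)
    have h1 := hr' c
    have h2 := h1.trans (hr c)
    obtain ⟨ih0, ih1, ih2⟩ := ih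
    rcases h with h | h
    · simp only [ofCode_ex1 h, qd, fv1, fv2, Finset.mem_sdiff]
      exact ⟨by omega, fun i hi => (ih1 i hi.1).trans h2, fun i hi => (ih2 i hi).trans h2⟩
    · simp only [ofCode_ex2 h, qd, fv1, fv2, Finset.mem_sdiff]
      exact ⟨by omega, fun i hi => (ih1 i hi).trans h2, fun i hi => (ih2 i hi.1).trans h2⟩

end MSO

end decoding

/-! ## Primitive recursion along formulas -/

section recursion

theorem Primrec.unpair_fst {α : Type*} [Primcodable α] {g : α → ℕ} (hg : Primrec g) :
    Primrec fun x => (g x).unpair.1 := Primrec.fst.comp (Primrec.unpair.comp hg)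

theorem Primrec.unpair_snd {α : Type*} [Primcodable α] {g : α → ℕ} (hg : Primrec g) :
    Primrec fun x => (g x).unpair.2 := Primrec.snd.comp (Primrec.unpair.comp hg)

theorem primrec₂_of_code_rec {α β : Type*} [Primcodable α] [Primcodable β]
    {f t : α → ℕ × β → Bool} {L : α → ℕ × β → List β} {e : Bool} (ht : Primrec₂ t)
    (hL : Primrec₂ L)
    (atom : ∀ a c b, c.unpair.1 ≤ 2 ∨ 7 ≤ c.unpair.1 → f a (c, b) = t a (c, b))
    (not : ∀ a c b, c.unpair.1 = 3 → f a (c, b) = (f a (c.unpair.2, b) ^^ e))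
    (and : ∀ a c b, c.unpair.1 = 4 →
      f a (c, b) = (f a (c.unpair.2.unpair.1, b) && f a (c.unpair.2.unpair.2, b)))
    (ex : ∀ a c b, c.unpair.1 = 5 ∨ c.unpair.1 = 6 →
      f a (c, b) = (L a (c, b)).any fun b' => f a (c.unpair.2.unpair.2, b')) :
    Primrec₂ f := by
  let calls (a : α) (x : ℕ × β) : List (ℕ × β) :=
    if x.1.unpair.1 = 3 then [(x.1.unpair.2, x.2)]
    else if x.1.unpair.1 = 4 then
      [(x.1.unpair.2.unpair.1, x.2), (x.1.unpair.2.unpair.2, x.2)]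
    else if x.1.unpair.1 = 5 ∨ x.1.unpair.1 = 6 then
      (L a x).map fun b => (x.1.unpair.2.unpair.2, b)
    else []
  let step (a : α) (x : (ℕ × β) × List Bool) : Option Bool :=
    some (if x.1.1.unpair.1 = 3 then (x.2.headI ^^ e)
    else if x.1.1.unpair.1 = 4 then x.2.foldr (· && ·) true
    else if x.1.1.unpair.1 = 5 ∨ x.1.1.unpair.1 = 6 then x.2.foldr (· || ·) false
    else t a x.1)
  have heq {γ : Type _} [Primcodable γ] {g : γ → ℕ} (hg : Primrec g) (i : ℕ) :
      PrimrecPred fun x => g x = i := Primrec.eq.comp hg (Primrec.const i)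
  have hcalls : Primrec₂ calls := by
    have hc : Primrec fun x : α × ℕ × β => x.2.1 := Primrec.fst.comp Primrec.snd
    have hb : Primrec fun x : α × ℕ × β => x.2.2 := Primrec.snd.comp Primrec.snd
    have htag := heq (Primrec.unpair_fst hc)
    refine Primrec.ite (htag 3) ?_ (Primrec.ite (htag 4) ?_
      (Primrec.ite ((htag 5).or (htag 6)) ?_ (Primrec.const [])))
    · exact Primrec.list_cons.comp (Primrec.pair (Primrec.unpair_snd hc) hb) (Primrec.const [])
    · exact Primrec.list_cons.comp (Primrec.pair (Primrec.unpair_fst (Primrec.unpair_snd hc)) hb)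
        (Primrec.list_cons.comp (Primrec.pair (Primrec.unpair_snd (Primrec.unpair_snd hc)) hb)
          (Primrec.const []))
    · exact Primrec.list_map hL (Primrec.pair
        (Primrec.unpair_snd (Primrec.unpair_snd (hc.comp Primrec.fst))) Primrec.snd).to₂
  have hstep : Primrec₂ step := by
    have hc : Primrec fun x : α × (ℕ × β) × List Bool => x.2.1.1 :=
      Primrec.fst.comp (Primrec.fst.comp Primrec.snd)
    have hl : Primrec fun x : α × (ℕ × β) × List Bool => x.2.2 := Primrec.snd.comp Primrec.snd
    refine Primrec.option_some.comp (Primrec.ite (heq (Primrec.unpair_fst hc) 3) ?_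
      (Primrec.ite (heq (Primrec.unpair_fst hc) 4) ?_
      (Primrec.ite ((heq (Primrec.unpair_fst hc) 5).or (heq (Primrec.unpair_fst hc) 6)) ?_ ?_)))
    · exact (Primrec.dom_bool fun b => b ^^ e).comp (Primrec.list_headI.comp hl)
    · exact Primrec.list_foldr hl (Primrec.const true)
        (Primrec.and.comp (Primrec.fst.comp Primrec.snd) (Primrec.snd.comp Primrec.snd)).to₂
    · exact Primrec.list_foldr hl (Primrec.const false)
        (Primrec.or.comp (Primrec.fst.comp Primrec.snd) (Primrec.snd.comp Primrec.snd)).to₂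
    · exact ht.comp Primrec.fst (Primrec.fst.comp Primrec.snd)
  refine Primrec.nat_omega_rec f (m := fun _ x => x.1) (Primrec.fst.comp Primrec.snd).to₂
    hcalls hstep (fun a x x' hx' => ?_) fun a x => ?_
  · have h1 := x.1.unpair.2.unpair_left_le
    have h2 := x.1.unpair.2.unpair_right_le
    have h0 := MSO.snd_unpair_lt (c := x.1)
    simp only [calls] at hx'
    split_ifs at hx' with h h h
    · simp only [List.mem_singleton] at hx'
      rw [hx']
      exact h0 (by omega)
    · simp only [List.mem_cons, List.not_mem_nil, or_false] at hx'
      rcases hx' with rfl | rfl <;> simp only <;> omega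
    · simp only [List.mem_map] at hx'
      obtain ⟨b, -, rfl⟩ := hx'
      simp only
      omega
    · simp at hx'
  · obtain ⟨c, b⟩ := x
    simp only [step, calls, Option.some.injEq]
    by_cases h3 : c.unpair.1 = 3
    · simp [h3, not a c b h3]
    by_cases h4 : c.unpair.1 = 4
    · simp [h4, and a c b h4]
    by_cases h5 : c.unpair.1 = 5 ∨ c.unpair.1 = 6
    · rw [if_neg h3, if_neg h4, if_pos h5, if_neg h3, if_neg h4, if_pos h5, ex a c b h5]
      induction L a (c, b) with
      | nil => rfl
      | cons _ _ ih => simpa using congrArg (f a _ || ·) ih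
    · rw [if_neg h3, if_neg h4, if_neg h5, atom a c b (by omega)]

end recursion

/-! ## Recognizing sentences -/

section sentences

variable {n : ℕ}

/-- The number `c` is the code of a formula with free variables among those listed. -/
def IsCode (n : ℕ) (c : ℕ) (l₁ l₂ : List ℕ) : Prop :=
  (MSO.ofCode n c).encode = c ∧ (∀ i ∈ (MSO.ofCode n c).fv1, i ∈ l₁) ∧
    ∀ j ∈ (MSO.ofCode n c).fv2, j ∈ l₂

section isCode

variable {c : ℕ} {l₁ l₂ : List ℕ}

theorem eq_pair_unpair {c t : ℕ} (h : c.unpair.1 = t) : c = Nat.pair t c.unpair.2 := by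
  rw [← h, Nat.pair_unpair]

theorem pair_pair_eq_iff {c t : ℕ} (h : c.unpair.1 = t) (x y : ℕ) :
    Nat.pair t (Nat.pair x y) = c ↔ x = c.unpair.2.unpair.1 ∧ y = c.unpair.2.unpair.2 := by
  conv_lhs => rw [eq_pair_unpair h, ← Nat.pair_unpair c.unpair.2]
  simp only [Nat.pair_eq_pair, true_and]

theorem isCode_atom (h : c.unpair.1 ≤ 2 ∨ 7 ≤ c.unpair.1) : IsCode n c l₁ l₂ ↔
    (c.unpair.1 = 0 ∧ c.unpair.2.unpair.1 ∈ l₁ ∧ c.unpair.2.unpair.2 ∈ l₁) ∨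
    (c.unpair.1 = 1 ∧ c.unpair.2.unpair.1 < n ∧ c.unpair.2.unpair.2 ∈ l₁) ∨
    (c.unpair.1 = 2 ∧ c.unpair.2.unpair.1 ∈ l₁ ∧ c.unpair.2.unpair.2 ∈ l₂) := by
  have h0 (h : c.unpair.1 ≠ 0) : ¬ Nat.pair 0 (Nat.pair 0 0) = c := by
    rintro rfl
    simp at h
  rw [IsCode, MSO.ofCode]
  obtain h | h | h | h : c.unpair.1 = 0 ∨ c.unpair.1 = 1 ∨ c.unpair.1 = 2 ∨ 7 ≤ c.unpair.1 := by
    omega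
  · simp [h, MSO.encode, MSO.fv1, MSO.fv2, (eq_pair_unpair h).symm]
  · by_cases hn : c.unpair.2.unpair.1 < n
    · simp [h, hn, MSO.encode, MSO.fv1, MSO.fv2, (eq_pair_unpair h).symm]
    · simp only [h, hn]
      simpa [MSO.encode] using fun h' => absurd h' (h0 (by omega))
  · simp [h, MSO.encode, MSO.fv1, MSO.fv2, (eq_pair_unpair h).symm]
  · have hne (i : ℕ) (hi : i < 7) : c.unpair.1 ≠ i := by omega
    have := h0 (by omega)
    simp [hne, MSO.encode] at this ⊢
    exact fun h => absurd h this

theorem isCode_not (h : c.unpair.1 = 3) : IsCode n c l₁ l₂ ↔ IsCode n c.unpair.2 l₁ l₂ := by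
  have : (Nat.pair 3 (MSO.ofCode n c.unpair.2).encode = c) ↔
      (MSO.ofCode n c.unpair.2).encode = c.unpair.2 := by
    conv_lhs => rw [eq_pair_unpair h]
    simp
  simp only [IsCode, MSO.ofCode_not h, MSO.encode, MSO.fv1, MSO.fv2, this]

theorem isCode_and (h : c.unpair.1 = 4) : IsCode n c l₁ l₂ ↔
    IsCode n c.unpair.2.unpair.1 l₁ l₂ ∧ IsCode n c.unpair.2.unpair.2 l₁ l₂ := by
  simp only [IsCode, MSO.ofCode_and h, MSO.encode, MSO.fv1, MSO.fv2, pair_pair_eq_iff h,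
    Finset.mem_union, or_imp, forall_and]
  tauto

theorem isCode_ex1 (h : c.unpair.1 = 5) : IsCode n c l₁ l₂ ↔
    IsCode n c.unpair.2.unpair.2 (c.unpair.2.unpair.1 :: l₁) l₂ := by
  simp only [IsCode, MSO.ofCode_ex1 h, MSO.encode, MSO.fv1, MSO.fv2, pair_pair_eq_iff h, true_and,
    Finset.mem_sdiff,
    Finset.mem_singleton, List.mem_cons, and_imp, or_iff_not_imp_left]

theorem isCode_ex2 (h : c.unpair.1 = 6) : IsCode n c l₁ l₂ ↔
    IsCode n c.unpair.2.unpair.2 l₁ (c.unpair.2.unpair.1 :: l₂) := by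
  simp only [IsCode, MSO.ofCode_ex2 h, MSO.encode, MSO.fv1, MSO.fv2, pair_pair_eq_iff h, true_and,
    Finset.mem_sdiff,
    Finset.mem_singleton, List.mem_cons, and_imp, or_iff_not_imp_left]

end isCode

theorem PrimrecPred.list_mem {α : Type*} [Primcodable α] {f : α → ℕ} {l : α → List ℕ}
    (hf : Primrec f) (hl : Primrec l) : PrimrecPred fun a => f a ∈ l a := by
  have : PrimrecPred fun a => (l a).idxOf (f a) < (l a).length :=
    Primrec.nat_lt.comp (Primrec.list_idxOf.comp hf hl) (Primrec.list_length.comp hl)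
  exact this.of_eq fun a => List.idxOf_lt_length_iff

theorem primrec_isCode (n : ℕ) : PrimrecPred fun c => IsCode n c [] [] := by
  classical
  have hc : Primrec fun x : Unit × ℕ × List ℕ × List ℕ => x.2.1 := Primrec.fst.comp Primrec.snd
  have hl₁ : Primrec fun x : Unit × ℕ × List ℕ × List ℕ => x.2.2.1 :=
    Primrec.fst.comp (Primrec.snd.comp Primrec.snd)
  have hl₂ : Primrec fun x : Unit × ℕ × List ℕ × List ℕ => x.2.2.2 :=
    Primrec.snd.comp (Primrec.snd.comp Primrec.snd)
  have htag (i : ℕ) : PrimrecPred fun x : Unit × ℕ × List ℕ × List ℕ => x.2.1.unpair.1 = i :=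
    Primrec.eq.comp (Primrec.unpair_fst hc) (Primrec.const i)
  have main : Primrec₂ fun (_ : Unit) (x : ℕ × List ℕ × List ℕ) =>
      decide (IsCode n x.1 x.2.1 x.2.2) := by
    refine primrec₂_of_code_rec (e := false)
      (t := fun _ x => decide (
        (x.1.unpair.1 = 0 ∧ x.1.unpair.2.unpair.1 ∈ x.2.1 ∧ x.1.unpair.2.unpair.2 ∈ x.2.1) ∨
        (x.1.unpair.1 = 1 ∧ x.1.unpair.2.unpair.1 < n ∧ x.1.unpair.2.unpair.2 ∈ x.2.1) ∨
        (x.1.unpair.1 = 2 ∧ x.1.unpair.2.unpair.1 ∈ x.2.1 ∧ x.1.unpair.2.unpair.2 ∈ x.2.2)))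
      (L := fun _ x => [if x.1.unpair.1 = 5 then (x.1.unpair.2.unpair.1 :: x.2.1, x.2.2)
        else (x.2.1, x.1.unpair.2.unpair.1 :: x.2.2)]) ?_ ?_ ?_ ?_ ?_ ?_
    · have h1 := Primrec.unpair_fst (Primrec.unpair_snd hc)
      have h2 := Primrec.unpair_snd (Primrec.unpair_snd hc)
      exact PrimrecPred.decide
        (((htag 0).and ((PrimrecPred.list_mem h1 hl₁).and (PrimrecPred.list_mem h2 hl₁))).or
        (((htag 1).and ((Primrec.nat_lt.comp h1 (Primrec.const n)).and
          (PrimrecPred.list_mem h2 hl₁))).or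
        ((htag 2).and ((PrimrecPred.list_mem h1 hl₁).and (PrimrecPred.list_mem h2 hl₂)))))
    · exact Primrec.list_cons.comp (Primrec.ite (htag 5)
        (Primrec.pair (Primrec.list_cons.comp (Primrec.unpair_fst (Primrec.unpair_snd hc)) hl₁) hl₂)
        (Primrec.pair hl₁
          (Primrec.list_cons.comp (Primrec.unpair_fst (Primrec.unpair_snd hc)) hl₂)))
        (Primrec.const [])
    · intro _ c b h
      simp only [isCode_atom h]
    · intro _ c b h
      simp [isCode_not h]
    · intro _ c b h
      simp [isCode_and h]
    · rintro _ c b (h | h)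
      · simp [isCode_ex1 h, h]
      · simp [isCode_ex2 h, h]
  have := main.comp (Primrec.const ()) (Primrec.pair .id (Primrec.const ([], [])))
  exact Primrec.primrecPred this

theorem isCode_nil_iff {c : ℕ} :
    IsCode n c [] [] ↔ (MSO.ofCode n c).encode = c ∧ (MSO.ofCode n c).IsSentence := by
  simp only [IsCode, MSO.IsSentence, List.not_mem_nil, imp_false, Finset.eq_empty_iff_forall_notMem]

theorem mem_theoryCodes_iff {A : Type} {r : A → A → Prop} {P : Fin n → Set A} {c : ℕ} :
    c ∈ MSO.TheoryCodes r P ↔ IsCode n c [] [] ∧ (MSO.ofCode n c).TrueIn r P := by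
  rw [isCode_nil_iff]
  constructor
  · rintro ⟨φ, hφ, rfl, h⟩
    rw [MSO.ofCode_encode]
    exact ⟨⟨rfl, hφ⟩, h⟩
  · rintro ⟨⟨h1, h2⟩, h⟩
    exact ⟨_, h2, h1, h⟩

end sentences

/-! ## Bounded witnesses in ultimately periodic structures -/

section witness

variable {n : ℕ} {P : Fin n → Set ℕ} {v : ℕ → ℕ} {V : ℕ → Set ℕ} {φ : MSO n} {c w : ℕ}

/-- The labelling of `ℕ` by the predicates of a structure followed by the values of the first- and
second-order variables with indices at most `c`. -/
def envLabel (P : Fin n → Set ℕ) (v : ℕ → ℕ) (V : ℕ → Set ℕ) (c i : ℕ) : Set ℕ :=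
  if h : i < n then P ⟨i, h⟩ else if i < n + (c + 1) then {v (i - n)} else V (i - (n + (c + 1)))

theorem represents_envLabel : Represents id (· < ·) P (envLabel P v V c) where
  injective := Function.injective_id
  rel _ _ := Iff.rfl
  pred k a := by simp [envLabel]

theorem envLabel_fst {i : ℕ} (hi : i ≤ c) : envLabel P v V c (n + i) = {v i} := by
  rw [envLabel, dif_neg (by omega), if_pos (by omega), Nat.add_sub_cancel_left]

theorem envLabel_snd {j : ℕ} : envLabel P v V c (n + (c + 1) + j) = V j := by
  rw [envLabel, dif_neg (by omega), if_neg (by omega), Nat.add_sub_cancel_left]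

/-- A bound on the elements, preperiods and periods which suffice as witnesses of formulas
with code `c` over structures with parameters bounded by `w`. -/
def witnessBound (n c w : ℕ) : ℕ :=
  w + 1 + tyBound c (c + (n + (c + 1) + (c + 1) + 1)) * (w + 1).factorial

theorem exists_periodic_typ_envLabel (hP : ∀ k, PeriodicFrom (w + 1) (w + 1).factorial (P k))
    (hv : ∀ i, v i ≤ w) (hV : ∀ j, PeriodicFrom (w + 1) (w + 1).factorial (V j)) (S : Set ℕ) :
    ∃ p q S', p ≤ witnessBound n c w ∧ 0 < q ∧ q ≤ witnessBound n c w ∧ PeriodicFrom p q S' ∧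
      typ c (n + (c + 1) + (c + 1) + 1) (Set.range (id : ℕ → ℕ))
        (Function.update (envLabel P v V c) (n + (c + 1) + (c + 1)) S) =
      typ c (n + (c + 1) + (c + 1) + 1) (Set.range (id : ℕ → ℕ))
        (Function.update (envLabel P v V c) (n + (c + 1) + (c + 1)) S') := by
  have hQ (i : ℕ) : PeriodicFrom (w + 1) (w + 1).factorial (envLabel P v V c i) := by
    unfold envLabel
    split_ifs
    · exact hP _
    · intro x hx
      have := hv (i - n)
      simp only [Set.mem_singleton_iff]
      omega
    · exact hV _
  rw [Set.range_id]
  obtain ⟨p, q, S', hp, hq, hqN, hS', h⟩ := exists_periodic_typ_eq (card_ty_le c _)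
    (Nat.factorial_pos (w + 1)) (fun i (_ : i < n + (c + 1) + (c + 1)) => hQ i) S
  exact ⟨p, q, S', hp, hq, hqN.trans (Nat.le_add_left _ _), hS', h⟩

theorem exists_sat_update_fst_iff (hP : ∀ k, PeriodicFrom (w + 1) (w + 1).factorial (P k))
    (hv : ∀ i, v i ≤ w) (hV : ∀ j, PeriodicFrom (w + 1) (w + 1).factorial (V j))
    (hφ : φ.qd ≤ c) (h1 : ∀ i ∈ φ.fv1, i ≤ c) (h2 : ∀ j ∈ φ.fv2, j ≤ c) (i : ℕ) :
    (∃ a, φ.Sat (· < ·) P (Function.update v i a) V) ↔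
      ∃ a ≤ witnessBound n c w, φ.Sat (· < ·) P (Function.update v i a) V := by
  refine ⟨fun ⟨a, ha⟩ => ?_, fun ⟨a, _, ha⟩ => ⟨a, ha⟩⟩
  obtain ⟨p, q, S', hp, hq, -, hS', h⟩ := exists_periodic_typ_envLabel (c := c) hP hv hV {a}
  obtain ⟨b, hb⟩ := exists_singleton_of_typ_eq (a := a) Function.injective_id h (by simp)
  have hbp : b < p := by
    by_contra! hpb
    have := (hb _).1 ((hS' b hpb).1 ((hb b).2 rfl))
    omega
  refine ⟨b, hbp.le.trans hp, (sat_iff_of_typ_eq φ (by omega) (represents_envLabel.update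
    (by omega) _) (represents_envLabel.update (by omega) _) h hφ
    (σ := fun i' => if i' = i then n + (c + 1) + (c + 1) else n + i')
    (τ := fun j => n + (c + 1) + j) (fun i' hi' => ?_) fun j hj => ?_).1 ha⟩
  · have := h1 i' hi'
    by_cases hii : i' = i
    · simp only [hii, if_true, Function.update_self, hb]
      simp
    · simp only [hii, if_false, ne_eq, not_false_iff, Function.update_of_ne]
      rw [Function.update_of_ne (by omega), Function.update_of_ne (by omega), envLabel_fst this]
      exact ⟨by omega, by simp, by simp⟩
  · have := h2 j hj
    rw [Function.update_of_ne (by omega), Function.update_of_ne (by omega), envLabel_snd]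
    exact ⟨by omega, by simp, by simp⟩

theorem exists_sat_update_snd_iff (hP : ∀ k, PeriodicFrom (w + 1) (w + 1).factorial (P k))
    (hv : ∀ i, v i ≤ w) (hV : ∀ j, PeriodicFrom (w + 1) (w + 1).factorial (V j))
    (hφ : φ.qd ≤ c) (h1 : ∀ i ∈ φ.fv1, i ≤ c) (h2 : ∀ j ∈ φ.fv2, j ≤ c) (j : ℕ) :
    (∃ S, φ.Sat (· < ·) P v (Function.update V j S)) ↔
      ∃ s ≤ lassoBound (witnessBound n c w),
        φ.Sat (· < ·) P v (Function.update V j (lassoSet s)) := by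
  refine ⟨fun ⟨S, hS⟩ => ?_, fun ⟨s, _, hs⟩ => ⟨lassoSet s, hs⟩⟩
  obtain ⟨p, q, S', hp, hq, hqN, hS', h⟩ := exists_periodic_typ_envLabel (c := c) hP hv hV S
  obtain ⟨s, hs, rfl⟩ := exists_lassoSet_eq hS' hq hp hqN
  refine ⟨s, hs, (sat_iff_of_typ_eq φ (by omega) (represents_envLabel.update
    (by omega) _) (represents_envLabel.update (by omega) _) h hφ
    (σ := fun i => n + i) (τ := fun j' => if j' = j then n + (c + 1) + (c + 1)
      else n + (c + 1) + j') (fun i hi => ?_) fun j' hj' => ?_).1 hS⟩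
  · have := h1 i hi
    rw [Function.update_of_ne (by omega), Function.update_of_ne (by omega), envLabel_fst this]
    exact ⟨by omega, by simp, by simp⟩
  · have := h2 j' hj'
    by_cases hjj : j' = j
    · simp [hjj]
    · simp only [hjj, if_false, ne_eq, not_false_iff, Function.update_of_ne]
      rw [Function.update_of_ne (by omega), Function.update_of_ne (by omega), envLabel_snd]
      exact ⟨by omega, by simp, by simp⟩

end witness

/-! ## Evaluating formulas in ultimately periodic structures -/

section primrec

theorem primrec₂_pow : Primrec₂ fun a b : ℕ => a ^ b := Primrec₂.unpaired'.1 Nat.Primrec.pow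

theorem primrec_factorial : Primrec Nat.factorial := by
  refine (Primrec.nat_rec₁ (f := fun i a => (i + 1) * a) 1
    (Primrec.nat_mul.comp (Primrec.succ.comp Primrec.fst) Primrec.snd).to₂).of_eq fun i => ?_
  induction i with
  | zero => rfl
  | succ i ih => exact (congrArg ((i + 1) * ·) ih)

theorem primrec₂_lassoBit : Primrec₂ lassoBit := by
  have hp := Primrec.unpair_fst (Primrec.fst (α := ℕ) (β := ℕ))
  have hq := Primrec.unpair_fst (Primrec.unpair_snd (Primrec.fst (α := ℕ) (β := ℕ)))
  have hm := Primrec.unpair_snd (Primrec.unpair_snd (Primrec.fst (α := ℕ) (β := ℕ)))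
  have hx : Primrec fun a : ℕ × ℕ => a.2 := Primrec.snd
  have hidx := Primrec.ite (Primrec.nat_lt.comp hx hp) hx (Primrec.nat_add.comp hp
    (Primrec.nat_mod.comp (Primrec.nat_sub.comp hx hp) (Primrec.succ.comp hq)))
  refine (Primrec.eq.comp (Primrec.nat_mod.comp (Primrec.nat_div.comp hm
    (primrec₂_pow.comp (Primrec.const 2) hidx)) (Primrec.const 2))
    (Primrec.const 1)).decide.of_eq fun a => ?_
  rw [lassoBit, Nat.testBit_eq_decide_div_mod_eq]

theorem primrec_lassoBound : Primrec lassoBound :=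
  Primrec₂.natPair.comp .id (Primrec₂.natPair.comp .id
    (primrec₂_pow.comp (Primrec.const 2) (Primrec.nat_add.comp .id .id)))

theorem primrec₂_tyBound : Primrec₂ tyBound := by
  have h := primrec₂_pow.comp (Primrec.const 2)
    (Primrec.nat_mul.comp (Primrec.snd (α := ℕ) (β := ℕ)) Primrec.snd)
  exact Primrec.nat_iterate Primrec.fst (Primrec.nat_mul.comp h h)
    (primrec₂_pow.comp (Primrec.const 2) Primrec.snd).to₂

theorem primrec₂_witnessBound (n : ℕ) : Primrec₂ (witnessBound n) := by
  have hc : Primrec fun a : ℕ × ℕ => a.1 := Primrec.fst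
  have hc' := Primrec.succ.comp hc
  have hw : Primrec fun a : ℕ × ℕ => a.2 + 1 := Primrec.succ.comp Primrec.snd
  exact Primrec.nat_add.comp hw (Primrec.nat_mul.comp (primrec₂_tyBound.comp hc
    (Primrec.nat_add.comp hc (Primrec.succ.comp (Primrec.nat_add.comp
      (Primrec.nat_add.comp (Primrec.const n) hc') hc')))) (primrec_factorial.comp hw))

end primrec

section evaluation

/-- The value at `i` of the finitely supported function given by an association list. -/
def look (l : List (ℕ × ℕ)) (i : ℕ) : ℕ := l.foldr (fun p a => if p.1 = i then p.2 else a) 0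

theorem look_cons (i x : ℕ) (l : List (ℕ × ℕ)) :
    look ((i, x) :: l) = Function.update (look l) i x := by
  ext j
  simp only [look, List.foldr_cons, Function.update_apply, eq_comm (a := j)]

theorem primrec₂_look : Primrec₂ look :=
  Primrec.list_foldr Primrec.fst (Primrec.const 0) (Primrec.ite
    (Primrec.eq.comp (Primrec.fst.comp (Primrec.fst.comp Primrec.snd))
      (Primrec.snd.comp Primrec.fst))
    (Primrec.snd.comp (Primrec.fst.comp Primrec.snd)) (Primrec.snd.comp Primrec.snd)).to₂

/-- A bound on the values of an association list. -/
def lookBound (l : List (ℕ × ℕ)) : ℕ := l.foldr (fun p a => p.2 + a) 0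

theorem look_le (l : List (ℕ × ℕ)) (i : ℕ) : look l i ≤ lookBound l := by
  induction l with
  | nil => simp [look]
  | cons p l ih =>
    change (if p.1 = i then p.2 else look l i) ≤ p.2 + lookBound l
    split_ifs <;> omega

theorem primrec_lookBound : Primrec lookBound :=
  Primrec.list_foldr .id (Primrec.const 0) (Primrec.nat_add.comp
    (Primrec.snd.comp (Primrec.fst.comp Primrec.snd)) (Primrec.snd.comp Primrec.snd)).to₂

variable (n : ℕ)

/-- The ultimately periodic predicates coded by a list. -/
def lassoPred (l : List (ℕ × ℕ)) (k : Fin n) : Set ℕ := lassoSet (look l k)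

/-- The parameters of a bounded search for a witness of a quantifier. -/
def searchBound (l : List (ℕ × ℕ)) (x : ℕ × List (ℕ × ℕ) × List (ℕ × ℕ)) : ℕ :=
  lassoBound (witnessBound n x.1.unpair.2.unpair.2
    (lookBound l + lookBound x.2.1 + lookBound x.2.2)) + 1

theorem primrec₂_searchBound : Primrec₂ (searchBound n) :=
  Primrec.succ.comp (primrec_lassoBound.comp ((primrec₂_witnessBound n).comp
    (Primrec.unpair_snd (Primrec.unpair_snd (Primrec.fst.comp Primrec.snd)))
    (Primrec.nat_add.comp (Primrec.nat_add.comp (primrec_lookBound.comp Primrec.fst)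
      (primrec_lookBound.comp (Primrec.fst.comp (Primrec.snd.comp Primrec.snd))))
      (primrec_lookBound.comp (Primrec.snd.comp (Primrec.snd.comp Primrec.snd))))))

open Classical in
/-- The truth value of the formula with code `x.1` under an assignment of codes. -/
noncomputable def evalCode (l : List (ℕ × ℕ)) (x : ℕ × List (ℕ × ℕ) × List (ℕ × ℕ)) : Bool :=
  decide ((MSO.ofCode n x.1).Sat (· < ·) (lassoPred n l) (look x.2.1)
    fun j => lassoSet (look x.2.2 j))

variable {n}

theorem lassoSet_look_cons (i x : ℕ) (l : List (ℕ × ℕ)) :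
    (fun j => lassoSet (look ((i, x) :: l) j)) =
      Function.update (fun j => lassoSet (look l j)) i (lassoSet x) := by
  ext1 j
  rw [look_cons, Function.update_apply, Function.update_apply]
  split_ifs <;> rfl

theorem periodicFrom_lassoSet_look {l : List (ℕ × ℕ)} {w : ℕ} (h : lookBound l ≤ w) (j : ℕ) :
    PeriodicFrom (w + 1) (w + 1).factorial (lassoSet (look l j)) :=
  periodicFrom_lassoSet_factorial ((look_le l j).trans h)

theorem evalCode_atom (l e₁ e₂ : List (ℕ × ℕ)) {c : ℕ} (h : c.unpair.1 ≤ 2 ∨ 7 ≤ c.unpair.1) :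
    evalCode n l (c, e₁, e₂) =
      if c.unpair.1 = 0 then decide (look e₁ c.unpair.2.unpair.1 < look e₁ c.unpair.2.unpair.2)
      else if c.unpair.1 = 1 then decide (c.unpair.2.unpair.1 < n) &&
        lassoBit (look l c.unpair.2.unpair.1) (look e₁ c.unpair.2.unpair.2)
      else if c.unpair.1 = 2 then
        lassoBit (look e₂ c.unpair.2.unpair.2) (look e₁ c.unpair.2.unpair.1)
      else false := by
  simp only [evalCode]
  rw [MSO.ofCode]
  obtain h | h | h | h : c.unpair.1 = 0 ∨ c.unpair.1 = 1 ∨ c.unpair.1 = 2 ∨ 7 ≤ c.unpair.1 := by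
    omega
  · simp [h, MSO.Sat]
  · by_cases hn : c.unpair.2.unpair.1 < n
    · simp [h, hn, MSO.Sat, lassoPred, lassoSet]
    · simp [h, hn, MSO.Sat]
  · simp [h, MSO.Sat, lassoSet]
  · have hne (i : ℕ) (hi : i < 7) : c.unpair.1 ≠ i := by omega
    simp [hne, MSO.Sat]

theorem evalCode_ex1 (l e₁ e₂ : List (ℕ × ℕ)) {c : ℕ} (h : c.unpair.1 = 5) :
    evalCode n l (c, e₁, e₂) = (List.range (searchBound n l (c, e₁, e₂))).any fun a =>
      evalCode n l (c.unpair.2.unpair.2, (c.unpair.2.unpair.1, a) :: e₁, e₂) := by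
  obtain ⟨h0, h1, h2⟩ := MSO.ofCode_bounds (n := n) c.unpair.2.unpair.2
  have key := exists_sat_update_fst_iff (P := lassoPred n l) (v := look e₁)
    (V := fun j => lassoSet (look e₂ j)) (w := lookBound l + lookBound e₁ + lookBound e₂)
    (fun k => periodicFrom_lassoSet_look (by omega) _)
    (fun i => (look_le e₁ i).trans (by omega))
    (fun j => periodicFrom_lassoSet_look (by omega) _) h0 h1 h2 c.unpair.2.unpair.1
  rw [Bool.eq_iff_iff]
  simp only [evalCode, MSO.ofCode_ex1 h, MSO.Sat, List.any_eq_true, List.mem_range,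
    decide_eq_true_eq, look_cons]
  refine ⟨fun h => ?_, fun ⟨a, _, h⟩ => ⟨a, h⟩⟩
  obtain ⟨a, ha, h⟩ := key.1 h
  exact ⟨a, Nat.lt_succ_of_le (ha.trans (Nat.left_le_pair _ _)), h⟩

theorem evalCode_ex2 (l e₁ e₂ : List (ℕ × ℕ)) {c : ℕ} (h : c.unpair.1 = 6) :
    evalCode n l (c, e₁, e₂) = (List.range (searchBound n l (c, e₁, e₂))).any fun a =>
      evalCode n l (c.unpair.2.unpair.2, e₁, (c.unpair.2.unpair.1, a) :: e₂) := by
  obtain ⟨h0, h1, h2⟩ := MSO.ofCode_bounds (n := n) c.unpair.2.unpair.2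
  have key := exists_sat_update_snd_iff (P := lassoPred n l) (v := look e₁)
    (V := fun j => lassoSet (look e₂ j)) (w := lookBound l + lookBound e₁ + lookBound e₂)
    (fun k => periodicFrom_lassoSet_look (by omega) _)
    (fun i => (look_le e₁ i).trans (by omega))
    (fun j => periodicFrom_lassoSet_look (by omega) _) h0 h1 h2 c.unpair.2.unpair.1
  rw [Bool.eq_iff_iff]
  simp only [evalCode, MSO.ofCode_ex2 h, MSO.Sat, List.any_eq_true, List.mem_range,
    decide_eq_true_eq, lassoSet_look_cons]
  exact key.trans (exists_congr fun a => and_congr_left fun _ => Nat.lt_succ_iff.symm)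

theorem primrec₂_evalCode (n : ℕ) : Primrec₂ (evalCode n) := by
  have hl : Primrec fun x : List (ℕ × ℕ) × ℕ × List (ℕ × ℕ) × List (ℕ × ℕ) => x.1 := Primrec.fst
  have hc : Primrec fun x : List (ℕ × ℕ) × ℕ × List (ℕ × ℕ) × List (ℕ × ℕ) => x.2.1 :=
    Primrec.fst.comp Primrec.snd
  have he₁ : Primrec fun x : List (ℕ × ℕ) × ℕ × List (ℕ × ℕ) × List (ℕ × ℕ) => x.2.2.1 :=
    Primrec.fst.comp (Primrec.snd.comp Primrec.snd)
  have he₂ : Primrec fun x : List (ℕ × ℕ) × ℕ × List (ℕ × ℕ) × List (ℕ × ℕ) => x.2.2.2 :=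
    Primrec.snd.comp (Primrec.snd.comp Primrec.snd)
  have htag (i : ℕ) : PrimrecPred fun x : List (ℕ × ℕ) × ℕ × List (ℕ × ℕ) × List (ℕ × ℕ) =>
      x.2.1.unpair.1 = i := Primrec.eq.comp (Primrec.unpair_fst hc) (Primrec.const i)
  have h1 := Primrec.unpair_fst (Primrec.unpair_snd hc)
  have h2 := Primrec.unpair_snd (Primrec.unpair_snd hc)
  refine primrec₂_of_code_rec (e := true)
    (t := fun l x =>
      if x.1.unpair.1 = 0 then
        decide (look x.2.1 x.1.unpair.2.unpair.1 < look x.2.1 x.1.unpair.2.unpair.2)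
      else if x.1.unpair.1 = 1 then decide (x.1.unpair.2.unpair.1 < n) &&
        lassoBit (look l x.1.unpair.2.unpair.1) (look x.2.1 x.1.unpair.2.unpair.2)
      else if x.1.unpair.1 = 2 then
        lassoBit (look x.2.2 x.1.unpair.2.unpair.2) (look x.2.1 x.1.unpair.2.unpair.1)
      else false)
    (L := fun l x => (List.range (searchBound n l x)).map fun a =>
      if x.1.unpair.1 = 5 then ((x.1.unpair.2.unpair.1, a) :: x.2.1, x.2.2)
      else (x.2.1, (x.1.unpair.2.unpair.1, a) :: x.2.2))
    ?_ ?_ ?_ ?_ ?_ ?_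
  · have h01 := primrec₂_look.comp he₁ h1
    have h02 := primrec₂_look.comp he₁ h2
    exact Primrec.ite (htag 0) (Primrec.nat_lt.comp h01 h02).decide
      (Primrec.ite (htag 1) (Primrec.and.comp (Primrec.nat_lt.comp h1 (Primrec.const n)).decide
        (primrec₂_lassoBit.comp (primrec₂_look.comp hl h1) h02))
      (Primrec.ite (htag 2) (primrec₂_lassoBit.comp (primrec₂_look.comp he₂ h2) h01)
        (Primrec.const false)))
  · have hcons := Primrec.pair (h1.comp (Primrec.fst (β := ℕ))) Primrec.snd
    exact Primrec.list_map (Primrec.list_range.comp (primrec₂_searchBound n)) (Primrec.ite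
      ((htag 5).comp Primrec.fst)
      (Primrec.pair (Primrec.list_cons.comp hcons (he₁.comp Primrec.fst)) (he₂.comp Primrec.fst))
      (Primrec.pair (he₁.comp Primrec.fst)
        (Primrec.list_cons.comp hcons (he₂.comp Primrec.fst)))).to₂
  · intro l c b h
    exact evalCode_atom l b.1 b.2 h
  · intro l c b h
    rw [Bool.eq_iff_iff]
    simp [evalCode, MSO.ofCode_not h, MSO.Sat]
  · intro l c b h
    rw [Bool.eq_iff_iff]
    simp [evalCode, MSO.ofCode_and h, MSO.Sat]
  · rintro l c ⟨e₁, e₂⟩ (h | h)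
    · simp only [evalCode_ex1 l e₁ e₂ h, h, if_true, List.any_map, Function.comp_def]
    · simp only [evalCode_ex2 l e₁ e₂ h, h, List.any_map, Function.comp_def]
      rfl

end evaluation

/-! ## From a uniformly homogeneous set to a decision procedure -/

section decision

variable {n : ℕ} {P : Fin n → Set ℕ} {h : ℕ → ℕ}

theorem computable_of_decidableSet_range (hh : StrictMono h) (hd : DecidableSet (Set.range h)) :
    Computable h := by
  classical
  have hex (x : ℕ) : ∃ y, y ∈ Set.range h ∧ x ≤ y := ⟨h x, ⟨x, rfl⟩, hh.le_apply⟩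
  have hcomp : ComputablePred fun a : ℕ × ℕ => a.2 ∈ Set.range h ∧ a.1 ≤ a.2 := by
    rw [computablePred_iff_computable_decide]
    refine (Primrec.and.to_comp.comp (ComputablePred.decide hd |>.comp Computable.snd)
      (PrimrecPred.decide Primrec.nat_le).to_comp).of_eq fun a => ?_
    simp
  have hnext := Computable.find hcomp hex
  refine (Computable.nat_rec .id (hnext.comp (Computable.const 0))
    (hnext.comp (Computable.succ.comp (Computable.snd.comp Computable.snd))).to₂).of_eq
    fun k => ?_
  induction k with
  | zero =>
    refine (Nat.find_eq_iff _).2 ⟨⟨⟨0, rfl⟩, Nat.zero_le _⟩, ?_⟩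
    rintro _ hy ⟨⟨j, rfl⟩, -⟩
    exact absurd (hh.lt_iff_lt.1 hy) (Nat.not_lt_zero j)
  | succ k ih =>
    simp only [id] at ih ⊢
    rw [ih]
    refine (Nat.find_eq_iff _).2 ⟨⟨⟨k + 1, rfl⟩, hh k.lt_succ_self⟩, ?_⟩
    rintro _ hy ⟨⟨j, rfl⟩, hj⟩
    have h1 := hh.lt_iff_lt.1 hy
    have h2 := hh.lt_iff_lt.1 (Nat.lt_of_succ_le hj)
    omega

theorem computable_lassoCode {b : ℕ → Bool} (hb : Computable b) {p q : ℕ → ℕ} (hp : Computable p)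
    (hq : Computable q) : Computable fun c => lassoCode b (p c) (q c) := by
  have hmask : Computable (bitMask b) := by
    refine Computable.nat_rec .id (Computable.const 0) (h := fun _ x =>
      bif b x.1 then 2 ^ x.1 + x.2 else x.2) (Computable.cond (hb.comp ?_) ?_ ?_)
    · exact Computable.fst.comp Computable.snd
    · exact (Primrec.nat_add.comp (primrec₂_pow.comp (Primrec.const 2)
        (Primrec.fst.comp Primrec.snd)) (Primrec.snd.comp Primrec.snd)).to_comp
    · exact Computable.snd.comp Computable.snd
  exact Primrec₂.natPair.to_comp.comp hp (Primrec₂.natPair.to_comp.comp hq (hmask.comp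
    (Computable.succ.comp (Primrec.nat_add.to_comp.comp hp hq))))

theorem exists_computable_look (m : ℕ) {f : ℕ → ℕ → ℕ} (hf : ∀ i < m, Computable (f i)) :
    ∃ F : ℕ → List (ℕ × ℕ), Computable F ∧ ∀ c, ∀ i < m, look (F c) i = f i c := by
  induction m with
  | zero => exact ⟨fun _ => [], Computable.const _, by simp⟩
  | succ m ih =>
    obtain ⟨F, hF, h⟩ := ih fun i hi => hf i (by omega)
    refine ⟨fun c => (m, f m c) :: F c, Computable.list_cons.comp
      (Computable.pair (Computable.const m) (hf m (by omega))) hF, fun c i hi => ?_⟩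
    rw [look_cons, Function.update_apply]
    split_ifs with him
    · rw [him]
    · exact h c i (by omega)

/-- The labelling of `ℕ` by the predicates of a structure. -/
def predLabel (P : Fin n → Set ℕ) (i : ℕ) : Set ℕ := if h : i < n then P ⟨i, h⟩ else ∅

theorem represents_predLabel : Represents id (· < ·) P (predLabel P) where
  injective := Function.injective_id
  rel _ _ := Iff.rfl
  pred k a := by simp [predLabel]

theorem represents_predLabel_sub (D : Set ℕ) :
    Represents (Subtype.val : D → ℕ) (subRel (· < ·) D) (subPred P D) (predLabel P) where
  injective := Subtype.val_injective
  rel _ _ := Iff.rfl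
  pred k a := by simp [predLabel, subPred]

theorem UniformlyHomogeneous.typ_eq (hh : UniformlyHomogeneous P h) (k : ℕ) {i j i' j' : ℕ}
    (hij : i < j) (hij' : i' < j') :
    typ k n (Set.Ico (h (k + 2 + i)) (h (k + 2 + j))) (predLabel P) =
      typ k n (Set.Ico (h (k + 2 + i')) (h (k + 2 + j'))) (predLabel P) := by
  have hne {i j : ℕ} (hij : i < j) : Nonempty (Set.Ico (h (k + 2 + i)) (h (k + 2 + j))) :=
    (Set.nonempty_Ico.2 (hh.1 (by omega))).to_subtype
  have := hne hij
  have := hne hij'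
  simpa only [Subtype.range_coe] using typ_eq_of_equivType (represents_predLabel_sub _)
    (represents_predLabel_sub _) (hh.2 (k + 2) i j i' j' hij hij')

/-- A structure with a uniformly homogeneous set agrees up to quantifier depth `k` with an
ultimately periodic structure. -/
theorem UniformlyHomogeneous.typ_univ (hh : UniformlyHomogeneous P h) (k : ℕ)
    {P' : Fin n → Set ℕ}
    (hP' : ∀ i x, x ∈ P' i ↔ (if x < h (k + 2) then x else
      h (k + 2) + (x - h (k + 2)) % (h (k + 3) - h (k + 2) - 1 + 1)) ∈ P i) :
    typ k n Set.univ (predLabel P) = typ k n Set.univ (predLabel P') := by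
  have hlt : h (k + 2) < h (k + 3) := hh.1 (by omega)
  obtain ⟨q, hq⟩ := Nat.exists_eq_add_of_lt hlt
  rw [show h (k + 3) - h (k + 2) - 1 + 1 = q + 1 by omega] at hP'
  refine typ_univ_eq (g := fun i => h (k + 2 + i)) (g' := fun i => h (k + 2) + i * (q + 1))
    (hh.1.comp fun i j hij => Nat.add_lt_add_left hij _)
    (fun i j hij => Nat.add_lt_add_left (Nat.mul_lt_mul_of_pos_right hij q.succ_pos) _) ?_
    fun i => ?_
  · simp only [Nat.add_zero, Nat.zero_mul]
    refine typ_congr fun i hi x hx => ?_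
    simp only [predLabel, dif_pos hi, hP', if_pos hx.2]
  · have h1 := hh.typ_eq k (Nat.lt_succ_self i) Nat.zero_lt_one
    have h2 := typ_Ico_add (k := k) (m := n) (a := h (k + 2)) (b := h (k + 3)) (Q := predLabel P)
      (Q' := predLabel P') (i * (q + 1)) fun j hj x hx => ?_
    · refine (h1.trans h2).trans ?_
      rw [hq]
      congr 2
      ring
    · have hge : ¬ x + i * (q + 1) < h (k + 2) := by have := hx.1; omega
      have hsub : x + i * (q + 1) - h (k + 2) = x - h (k + 2) + i * (q + 1) := by
        have := hx.1; omega
      simp only [predLabel, dif_pos hj, hP', if_neg hge, hsub, Nat.add_mul_mod_self_right]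
      rw [Nat.mod_eq_of_lt (by have := hx.2; omega), Nat.add_sub_cancel' hx.1]

theorem decidableSet_theoryCodes (hP : ∀ i, DecidableSet (P i)) (hh : UniformlyHomogeneous P h)
    (hd : DecidableSet (Set.range h)) :
    DecidableSet (MSO.TheoryCodes (fun x y : ℕ => x < y) P) := by
  classical
  have hcomp := computable_of_decidableSet_range hh.1 hd
  have hc (i : ℕ) : Computable fun c => h (c + i) :=
    hcomp.comp (Primrec.nat_add.comp .id (Primrec.const i)).to_comp
  have hq : Computable fun c => h (c + 3) - h (c + 2) - 1 :=
    Primrec.nat_sub.to_comp.comp (Primrec.nat_sub.to_comp.comp (hc 3) (hc 2)) (Computable.const 1)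
  obtain ⟨F, hF, hlook⟩ := exists_computable_look n (f := fun i c =>
    lassoCode (fun x => decide (x ∈ predLabel P i)) (h (c + 2)) (h (c + 3) - h (c + 2) - 1))
    fun i hi => computable_lassoCode (by
      simp only [predLabel, dif_pos hi]
      exact ComputablePred.decide (hP ⟨i, hi⟩)) (hc 2) hq
  have heval : Computable fun c => evalCode n (F c) (c, [], []) :=
    (primrec₂_evalCode n).to_comp.comp hF (Computable.pair .id (Computable.const _))
  refine ComputablePred.computable_iff.2 ⟨_, Primrec.and.to_comp.comp
    (primrec_isCode n).decide.to_comp heval, funext fun c => propext ?_⟩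
  rw [mem_theoryCodes_iff, Bool.and_eq_true, decide_eq_true_eq]
  refine and_congr_right fun hcode => ?_
  have hs : (MSO.ofCode n c).IsSentence := (isCode_nil_iff.1 hcode).2
  have htyp := hh.typ_univ c (P' := lassoPred n (F c)) fun i x => by
    simp only [lassoPred, hlook c i i.2, lassoSet, Set.mem_ofPred_eq, lassoBit_lassoCode,
      predLabel, dif_pos i.2, decide_eq_true_eq]
  rw [← Set.range_id] at htyp
  rw [trueIn_iff_of_typ_eq hs represents_predLabel represents_predLabel htyp
    (MSO.ofCode_bounds c).1, trueIn_iff_sat hs (look []) (fun j => lassoSet (look [] j)),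
    evalCode, decide_eq_true_eq]

end decision

/-! ## Decidable families of sentences -/

section sentences

variable {n : ℕ}

namespace MSO

section encode

variable {α : Type*} [Primcodable α] {φ ψ : α → MSO n} {i : α → ℕ}

theorem primrec_encode_not (hφ : Primrec fun a => (φ a).encode) :
    Primrec fun a => (MSO.not (φ a)).encode :=
  Primrec₂.natPair.comp (Primrec.const 3) hφ

theorem primrec_encode_and (hφ : Primrec fun a => (φ a).encode)
    (hψ : Primrec fun a => (ψ a).encode) : Primrec fun a => (MSO.and (φ a) (ψ a)).encode :=
  Primrec₂.natPair.comp (Primrec.const 4) (Primrec₂.natPair.comp hφ hψ)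

theorem primrec_encode_ex1 (hi : Primrec i) (hφ : Primrec fun a => (φ a).encode) :
    Primrec fun a => (MSO.ex1 (i a) (φ a)).encode :=
  Primrec₂.natPair.comp (Primrec.const 5) (Primrec₂.natPair.comp hi hφ)

theorem primrec_encode_ex2 (hi : Primrec i) (hφ : Primrec fun a => (φ a).encode) :
    Primrec fun a => (MSO.ex2 (i a) (φ a)).encode :=
  Primrec₂.natPair.comp (Primrec.const 6) (Primrec₂.natPair.comp hi hφ)

end encode

/-- Existential quantification over all variables with index less than `b`. -/
def close (φ : MSO n) : ℕ → MSO n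
  | 0 => φ
  | b + 1 => .ex1 b (.ex2 b (close φ b))

theorem fv_close {φ : MSO n} {b : ℕ} :
    (∀ i ∈ (close φ b).fv1, i ∈ φ.fv1 ∧ b ≤ i) ∧ ∀ j ∈ (close φ b).fv2, j ∈ φ.fv2 ∧ b ≤ j := by
  induction b with
  | zero => simp [close]
  | succ b ih =>
    simp only [close, fv1, fv2, Finset.mem_sdiff, Finset.mem_singleton, and_imp]
    refine ⟨fun i hi hne => ?_, fun j hj hne => ?_⟩
    · have := ih.1 i hi
      exact ⟨this.1, by omega⟩
    · have := ih.2 j hj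
      exact ⟨this.1, by omega⟩

theorem isSentence_close (φ : MSO n) : (close φ (φ.encode + 1)).IsSentence := by
  obtain ⟨-, h1, h2⟩ := ofCode_bounds (n := n) φ.encode
  rw [ofCode_encode] at h1 h2
  obtain ⟨h3, h4⟩ := fv_close (φ := φ) (b := φ.encode + 1)
  refine ⟨Finset.eq_empty_iff_forall_notMem.2 fun i hi => ?_,
    Finset.eq_empty_iff_forall_notMem.2 fun j hj => ?_⟩
  · have := h3 i hi
    have := h1 i this.1
    omega
  · have := h4 j hj
    have := h2 j this.1
    omega

theorem sat_close {A : Type} [Nonempty A] {r : A → A → Prop} {P : Fin n → Set A} {φ : MSO n}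
    {t : Prop} (h : ∀ v V, φ.Sat r P v V ↔ t) (b : ℕ) (v : ℕ → A) (V : ℕ → Set A) :
    (close φ b).Sat r P v V ↔ t := by
  induction b generalizing v V with
  | zero => exact h v V
  | succ b ih => simp only [close, Sat, ih, exists_const]

end MSO

/-- A predicate expressible in a structure with decidable theory by an effective family of
formulas is decidable. -/
theorem computablePred_of_formula {α : Type} [Primcodable α] {A : Type} [Nonempty A]
    {r : A → A → Prop} {P : Fin n → Set A} (hT : DecidableSet (MSO.TheoryCodes r P))
    {φ : α → MSO n} (hφ : Primrec fun a => (φ a).encode) {t : α → Prop}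
    (h : ∀ a v V, (φ a).Sat r P v V ↔ t a) : ComputablePred t := by
  have hclose : Primrec fun a => ((φ a).close ((φ a).encode + 1)).encode := by
    refine (Primrec.nat_rec' (Primrec.succ.comp hφ) hφ (h := fun _ x =>
      Nat.pair 5 (Nat.pair x.1 (Nat.pair 6 (Nat.pair x.1 x.2)))) ?_).of_eq fun a => ?_
    · have h1 : Primrec fun x : α × ℕ × ℕ => x.2.1 := Primrec.fst.comp Primrec.snd
      have h2 : Primrec fun x : α × ℕ × ℕ => x.2.2 := Primrec.snd.comp Primrec.snd
      exact Primrec₂.natPair.comp (Primrec.const 5) (Primrec₂.natPair.comp h1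
        (Primrec₂.natPair.comp (Primrec.const 6) (Primrec₂.natPair.comp h1 h2)))
    · rw [← Nat.succ_eq_add_one]
      generalize (φ a).encode.succ = b
      induction b with
      | zero => rfl
      | succ b ih => simp only [MSO.close, MSO.encode, ← ih]
  classical
  refine (computablePred_iff_computable_decide.2
    ((ComputablePred.decide hT).comp hclose.to_comp)).of_eq fun a => ?_
  have hs := MSO.isSentence_close (φ a)
  rw [mem_theoryCodes_iff, isCode_nil_iff, MSO.ofCode_encode,
    trueIn_iff_sat hs (fun _ => Classical.arbitrary A) (fun _ => ∅), MSO.sat_close (h a)]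
  exact ⟨And.right, fun h => ⟨⟨rfl, hs⟩, h⟩⟩

end sentences

section numerals

variable {n : ℕ} {P : Fin n → Set ℕ} {v : ℕ → ℕ} {V : ℕ → Set ℕ}

namespace MSO

/-- The formula stating that the variables `i` and `j` are equal. -/
def eq (i j : ℕ) : MSO n := .and (.not (.lt i j)) (.not (.lt j i))

theorem sat_eq {i j : ℕ} : (eq i j : MSO n).Sat (· < ·) P v V ↔ v i = v j := by
  simp only [eq, Sat]
  omega

/-- The formula stating that the variable `0` has the value `m`. -/
def num : ℕ → MSO n
  | 0 => .not (.ex1 1 (.lt 1 0))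
  | m + 1 => .ex1 1 (.and (.and (.lt 1 0) (.not (.ex1 2 (.and (.lt 1 2) (.lt 2 0)))))
      (.ex1 0 (.and (eq 0 1) (num m))))

theorem sat_num (m : ℕ) : (num m : MSO n).Sat (· < ·) P v V ↔ v 0 = m := by
  induction m generalizing v with
  | zero => simp [num, Sat]; exact ⟨fun h => by have := h 0; omega, fun h => by omega⟩
  | succ m ih =>
    simp [num, Sat, sat_eq, ih]
    constructor
    · rintro h
      have := h.2 (m + 1)
      omega
    · intro h
      exact ⟨by omega, fun x hx => by omega⟩

theorem primrec_encode_num : Primrec fun m => (num m : MSO n).encode := by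
  refine (Primrec.nat_rec₁ (f := fun _ c => Nat.pair 5 (Nat.pair 1 (Nat.pair 4 (Nat.pair
    (MSO.and (.lt 1 0) (.not (.ex1 2 (.and (.lt 1 2) (.lt 2 0)))) : MSO n).encode
    (Nat.pair 5 (Nat.pair 0 (Nat.pair 4 (Nat.pair (eq 0 1 : MSO n).encode c))))))))
    (num 0 : MSO n).encode ?_).of_eq fun m => ?_
  · have hp (a : ℕ) {f : ℕ × ℕ → ℕ} (hf : Primrec f) : Primrec fun x => Nat.pair a (f x) :=
      Primrec₂.natPair.comp (Primrec.const a) hf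
    exact hp _ (hp _ (hp _ (hp _ (hp _ (hp _ (hp _ (hp _ Primrec.snd)))))))
  · induction m with
    | zero => rfl
    | succ m ih => simp only [num, encode, ← ih]

end MSO

/-- The predicates of a structure over `ℕ` with decidable theory are decidable. -/
theorem decidableSet_pred (hT : DecidableSet (MSO.TheoryCodes (fun x y : ℕ => x < y) P))
    (i : Fin n) : DecidableSet (P i) := by
  refine computablePred_of_formula hT (φ := fun m => .ex1 0 (.and (.pred i 0) (MSO.num m))) ?_ ?_
  · exact MSO.primrec_encode_ex1 (Primrec.const 0)
      (MSO.primrec_encode_and (Primrec.const _) MSO.primrec_encode_num)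
  · intro m v V
    simp [MSO.Sat, MSO.sat_num]

end numerals

/-! ## Defining equality of types -/

section sameType

variable {n : ℕ} {P : Fin n → Set ℕ} {v : ℕ → ℕ} {V : ℕ → Set ℕ}

/-- The labelling of `ℕ` by the predicates of a structure followed by the set variables
`2 * i + s`. -/
def varLabel (P : Fin n → Set ℕ) (V : ℕ → Set ℕ) (s i : ℕ) : Set ℕ :=
  if h : i < n then P ⟨i, h⟩ else V (2 * i + s)

theorem represents_varLabel (s : ℕ) : Represents id (· < ·) P (varLabel P V s) where
  injective := Function.injective_id
  rel _ _ := Iff.rfl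
  pred k a := by simp [varLabel]

theorem varLabel_update {m : ℕ} (hm : n ≤ m) (s : ℕ) (S : Set ℕ) :
    varLabel P (Function.update V (2 * m + s) S) s = Function.update (varLabel P V s) m S := by
  ext1 i
  by_cases him : i = m
  · subst him
    simp [varLabel, Nat.not_lt.2 hm]
  · have : 2 * i + s ≠ 2 * m + s := by omega
    simp [varLabel, him]

theorem varLabel_update_of_ne {m s s' : ℕ} (h : ∀ i, 2 * i + s ≠ 2 * m + s') (S : Set ℕ) :
    varLabel P (Function.update V (2 * m + s') S) s = varLabel P V s := by
  ext1 i
  simp only [varLabel, Function.update_of_ne (h i)]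

namespace MSO

/-- The formula stating that `x` lies in the interval from `a` to `b`. -/
def inIco (x a b : ℕ) : MSO n := .and (.not (.lt x a)) (.lt x b)

/-- The formula stating that labels `i` and `j` meet between `a` and `b`. -/
def meetsIn (a b s i j : ℕ) : MSO n :=
  .ex1 4 (.and (inIco 4 a b) (.and (label 4 i (2 * i + s)) (label 4 j (2 * j + s))))

/-- The formula stating that an element with label `i` precedes an element with label `j` between
`a` and `b`. -/
def precedesIn (a b s i j : ℕ) : MSO n :=
  .ex1 4 (.ex1 5 (.and (.and (inIco 4 a b) (inIco 5 a b))
    (.and (label 4 i (2 * i + s)) (.and (label 5 j (2 * j + s)) (.lt 4 5)))))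

/-- Logical equivalence. -/
def iff (φ ψ : MSO n) : MSO n := .and (.not (.and φ (.not ψ))) (.not (.and ψ (.not φ)))

/-- The conjunction of the first `m` members of a sequence of formulas. -/
def conj (f : ℕ → MSO n) : ℕ → MSO n
  | 0 => .not (.ex1 0 (.lt 0 0))
  | m + 1 => .and (f m) (conj f m)

/-- The formula stating that the labels `i` and `j` are situated in the same way in the two
intervals bounded by the variables `0`, `1` and `2`, `3`. -/
def sameAtoms (i j : ℕ) : MSO n :=
  .and (iff (meetsIn 0 1 1 i j) (meetsIn 2 3 2 i j))
    (iff (precedesIn 0 1 1 i j) (precedesIn 2 3 2 i j))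

/-- The formula stating that the two intervals bounded by the variables `0`, `1` and `2`, `3` have
the same type of depth `k` with respect to the first `s - k` labels. -/
def sameType (s : ℕ) : ℕ → MSO n
  | 0 => conj (fun i => conj (sameAtoms i) s) s
  | k + 1 =>
    .and (.not (.ex2 (2 * (s - (k + 1)) + 1) (.not (.ex2 (2 * (s - (k + 1)) + 2) (sameType s k)))))
      (.not (.ex2 (2 * (s - (k + 1)) + 2) (.not (.ex2 (2 * (s - (k + 1)) + 1) (sameType s k)))))

theorem sat_iff {φ ψ : MSO n} :
    (iff φ ψ).Sat (· < ·) P v V ↔ (φ.Sat (· < ·) P v V ↔ ψ.Sat (· < ·) P v V) := by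
  simp only [iff, Sat]
  tauto

theorem sat_conj {f : ℕ → MSO n} {m : ℕ} :
    (conj f m).Sat (· < ·) P v V ↔ ∀ i < m, (f i).Sat (· < ·) P v V := by
  induction m with
  | zero => simp [conj, Sat]
  | succ m ih => simp only [conj, Sat, ih, Nat.forall_lt_succ_right, and_comm]

theorem sat_varLabel (x i s : ℕ) :
    (label x i (2 * i + s) : MSO n).Sat (· < ·) P v V ↔ v x ∈ varLabel P V s i :=
  sat_label (represents_varLabel s) x fun h a => by simp [varLabel, Nat.not_lt.2 h]

theorem sat_meetsIn {a b s i j : ℕ} (ha : a < 4) (hb : b < 4) :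
    (meetsIn a b s i j : MSO n).Sat (· < ·) P v V ↔
      Meets (Set.Ico (v a) (v b)) (varLabel P V s) i j := by
  simp only [meetsIn, inIco, Sat, sat_varLabel, Function.update_self, Meets, Set.mem_Ico, not_lt,
    Function.update_of_ne ha.ne, Function.update_of_ne hb.ne]

theorem sat_precedesIn {a b s i j : ℕ} (ha : a < 4) (hb : b < 4) :
    (precedesIn a b s i j : MSO n).Sat (· < ·) P v V ↔
      Precedes (Set.Ico (v a) (v b)) (varLabel P V s) i j := by
  simp only [precedesIn, inIco, Sat, sat_varLabel, Function.update_self, Precedes, Set.mem_Ico,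
    not_lt, Function.update_of_ne ha.ne, Function.update_of_ne hb.ne,
    Function.update_of_ne (show (4 : ℕ) ≠ 5 by decide),
    Function.update_of_ne (show a ≠ 5 by omega), Function.update_of_ne (show b ≠ 5 by omega)]
  exact exists_congr fun x => ⟨fun ⟨y, h⟩ => ⟨h.1.1, y, h.1.2, h.2⟩,
    fun ⟨hx, y, hy, h⟩ => ⟨y, ⟨hx, hy⟩, h⟩⟩

theorem sat_sameType (k : ℕ) {m : ℕ} (hm : n ≤ m) :
    (sameType (k + m) k : MSO n).Sat (· < ·) P v V ↔
      typ k m (Set.Ico (v 0) (v 1)) (varLabel P V 1) =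
        typ k m (Set.Ico (v 2) (v 3)) (varLabel P V 2) := by
  induction k generalizing m V with
  | zero =>
    simp only [sameType, sat_conj, sameAtoms, Sat, sat_iff, typ_zero_eq_iff, Nat.zero_add,
      sat_meetsIn (show 0 < 4 by decide) (show 1 < 4 by decide),
      sat_meetsIn (show 2 < 4 by decide) (show 3 < 4 by decide),
      sat_precedesIn (show 0 < 4 by decide) (show 1 < 4 by decide),
      sat_precedesIn (show 2 < 4 by decide) (show 3 < 4 by decide)]
  | succ k ih =>
    have h1 (V : ℕ → Set ℕ) (S : Set ℕ) := varLabel_update (P := P) (V := V) hm 1 S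
    have h2 (V : ℕ → Set ℕ) (S : Set ℕ) := varLabel_update (P := P) (V := V) hm 2 S
    have h3 (V : ℕ → Set ℕ) (S : Set ℕ) := varLabel_update_of_ne (P := P) (V := V) (m := m)
      (s := 1) (s' := 2) (by omega) S
    have h4 (V : ℕ → Set ℕ) (S : Set ℕ) := varLabel_update_of_ne (P := P) (V := V) (m := m)
      (s := 2) (s' := 1) (by omega) S
    rw [typ_succ_eq_iff, sameType, show k + 1 + m - (k + 1) = m by omega,
      show k + 1 + m = k + (m + 1) by ring]
    simp only [Sat, ih (show n ≤ m + 1 by omega), not_exists, not_forall, not_not, h1, h2, h3, h4]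

theorem primrec_encode_label {α : Type*} [Primcodable α] {i j : α → ℕ} (x : ℕ) (hi : Primrec i)
    (hj : Primrec j) : Primrec fun a => (label x (i a) (j a) : MSO n).encode := by
  refine (Primrec.ite (Primrec.nat_lt.comp hi (Primrec.const n))
    (Primrec₂.natPair.comp (Primrec.const 1) (Primrec₂.natPair.comp hi (Primrec.const x)))
    (Primrec₂.natPair.comp (Primrec.const 2)
      (Primrec₂.natPair.comp (Primrec.const x) hj))).of_eq fun a => ?_
  unfold label
  split_ifs <;> rfl

theorem primrec_encode_conj {α : Type*} [Primcodable α] {f : α → ℕ → MSO n} {m : α → ℕ}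
    (hf : Primrec₂ fun a i => (f a i).encode) (hm : Primrec m) :
    Primrec fun a => (conj (f a) (m a)).encode := by
  refine (Primrec.nat_rec' hm (Primrec.const (conj (fun _ => .lt 0 0) 0 : MSO n).encode)
    (h := fun a x => Nat.pair 4 (Nat.pair (f a x.1).encode x.2)) ?_).of_eq fun a => ?_
  · exact Primrec₂.natPair.comp (Primrec.const 4) (Primrec₂.natPair.comp
      (hf.comp Primrec.fst (Primrec.fst.comp Primrec.snd)) (Primrec.snd.comp Primrec.snd))
  · induction m a with
    | zero => rfl
    | succ m ih => simp only [conj, encode, ← ih]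

theorem primrec_encode_iff {α : Type*} [Primcodable α] {φ ψ : α → MSO n}
    (hφ : Primrec fun a => (φ a).encode) (hψ : Primrec fun a => (ψ a).encode) :
    Primrec fun a => (iff (φ a) (ψ a)).encode :=
  primrec_encode_and (primrec_encode_not (primrec_encode_and hφ (primrec_encode_not hψ)))
    (primrec_encode_not (primrec_encode_and hψ (primrec_encode_not hφ)))

theorem primrec₂_encode_sameAtoms : Primrec₂ fun i j => (sameAtoms i j : MSO n).encode := by
  have hvar {f : ℕ × ℕ → ℕ} (hf : Primrec f) (s : ℕ) : Primrec fun x => 2 * f x + s :=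
    Primrec.nat_add.comp (Primrec.nat_mul.comp (Primrec.const 2) hf) (Primrec.const s)
  have hlabel {f : ℕ × ℕ → ℕ} (hf : Primrec f) (s y : ℕ) :
      Primrec fun x => (label y (f x) (2 * f x + s) : MSO n).encode :=
    primrec_encode_label y hf (hvar hf s)
  have hm (a b s : ℕ) : Primrec fun x : ℕ × ℕ => (meetsIn a b s x.1 x.2 : MSO n).encode :=
    primrec_encode_ex1 (Primrec.const 4) (primrec_encode_and (Primrec.const _)
      (primrec_encode_and (hlabel Primrec.fst s 4) (hlabel Primrec.snd s 4)))
  have hp (a b s : ℕ) : Primrec fun x : ℕ × ℕ => (precedesIn a b s x.1 x.2 : MSO n).encode :=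
    primrec_encode_ex1 (Primrec.const 4) (primrec_encode_ex1 (Primrec.const 5)
      (primrec_encode_and (Primrec.const _) (primrec_encode_and (hlabel Primrec.fst s 4)
        (primrec_encode_and (hlabel Primrec.snd s 5) (Primrec.const _)))))
  exact primrec_encode_and (primrec_encode_iff (hm 0 1 1) (hm 2 3 2))
    (primrec_encode_iff (hp 0 1 1) (hp 2 3 2))

theorem primrec₂_encode_sameType : Primrec₂ fun s k => (sameType s k : MSO n).encode := by
  have hbase : Primrec fun s => (sameType s 0 : MSO n).encode := by
    refine primrec_encode_conj (m := id) (f := fun s i => conj (sameAtoms i) s) ?_ .id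
    exact primrec_encode_conj (m := Prod.fst) (f := fun x : ℕ × ℕ => sameAtoms x.2)
      (primrec₂_encode_sameAtoms.comp (Primrec.snd.comp Primrec.fst) Primrec.snd) Primrec.fst
  refine (Primrec.nat_rec hbase (g := fun s x =>
    Nat.pair 4 (Nat.pair
      (Nat.pair 3 (Nat.pair 6 (Nat.pair (2 * (s - (x.1 + 1)) + 1)
        (Nat.pair 3 (Nat.pair 6 (Nat.pair (2 * (s - (x.1 + 1)) + 2) x.2))))))
      (Nat.pair 3 (Nat.pair 6 (Nat.pair (2 * (s - (x.1 + 1)) + 2)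
        (Nat.pair 3 (Nat.pair 6 (Nat.pair (2 * (s - (x.1 + 1)) + 1) x.2)))))))) ?_).of_eq
    fun s k => ?_
  · have hvar (i : ℕ) : Primrec fun x : ℕ × ℕ × ℕ => 2 * (x.1 - (x.2.1 + 1)) + i :=
      Primrec.nat_add.comp (Primrec.nat_mul.comp (Primrec.const 2) (Primrec.nat_sub.comp
        Primrec.fst (Primrec.succ.comp (Primrec.fst.comp Primrec.snd)))) (Primrec.const i)
    have hx : Primrec fun x : ℕ × ℕ × ℕ => x.2.2 := Primrec.snd.comp Primrec.snd
    have hpair (i j : ℕ) : Primrec fun x : ℕ × ℕ × ℕ =>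
        Nat.pair 3 (Nat.pair 6 (Nat.pair (2 * (x.1 - (x.2.1 + 1)) + i)
        (Nat.pair 3 (Nat.pair 6 (Nat.pair (2 * (x.1 - (x.2.1 + 1)) + j) x.2.2))))) :=
      Primrec₂.natPair.comp (Primrec.const 3) (Primrec₂.natPair.comp (Primrec.const 6)
        (Primrec₂.natPair.comp (hvar i) (Primrec₂.natPair.comp (Primrec.const 3)
        (Primrec₂.natPair.comp (Primrec.const 6) (Primrec₂.natPair.comp (hvar j) hx)))))
    exact Primrec₂.natPair.comp (Primrec.const 4) (Primrec₂.natPair.comp (hpair 1 2) (hpair 2 1))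
  · induction k with
    | zero => rfl
    | succ k ih =>
      conv_rhs => rw [sameType]
      simp only [encode, ← ih]

end MSO

end sameType

/-! ## Extracting a computable homogeneous set from a decidable theory -/

section chains

variable {n : ℕ} {P : Fin n → Set ℕ}

/-- From its element `h` on, the set `Y` is homogeneous for types of depth `k`. -/
def HomogeneousFrom (P : Fin n → Set ℕ) (Y : Set ℕ) (k h : ℕ) : Prop :=
  h ∈ Y ∧ ∀ a ∈ Y, ∀ b ∈ Y, ∀ a' ∈ Y, ∀ b' ∈ Y, h ≤ a → a < b → h ≤ a' → a' < b' →
    typ k n (Set.Ico a b) (predLabel P) = typ k n (Set.Ico a' b') (predLabel P)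

/-- The set `Y` is infinite, and from each element `h` of the list on, it is homogeneous for types
whose depth is the number of entries of the list behind `h`. -/
def Chain (P : Fin n → Set ℕ) (Y : Set ℕ) : List ℕ → Prop
  | [] => Y.Infinite
  | h :: l => HomogeneousFrom P Y l.length h ∧ Chain P Y l

theorem Chain.infinite {Y : Set ℕ} {l : List ℕ} (h : Chain P Y l) : Y.Infinite := by
  induction l with
  | nil => exact h
  | cons a l ih => exact ih h.2

theorem Chain.mem {Y : Set ℕ} {l : List ℕ} (h : Chain P Y l) {x : ℕ} (hx : x ∈ l) : x ∈ Y := by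
  induction l with
  | nil => simp at hx
  | cons a l ih =>
    rcases List.mem_cons.1 hx with rfl | hx
    exacts [h.1.1, ih h.2 hx]

theorem Chain.mono {Y Y' : Set ℕ} {l : List ℕ} (h : Chain P Y l) (hY : Y' ⊆ Y)
    (hinf : Y'.Infinite) (hl : ∀ x ∈ l, x ∈ Y') : Chain P Y' l := by
  induction l with
  | nil => exact hinf
  | cons a l ih =>
    exact ⟨⟨hl a (by simp), fun a ha b hb a' ha' b' hb' =>
      h.1.2 a (hY ha) b (hY hb) a' (hY ha') b' (hY hb')⟩,
      ih h.2 fun x hx => hl x (List.mem_cons_of_mem _ hx)⟩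

theorem exists_chain_cons {l : List ℕ} (hl : ∃ Y, Chain P Y l) :
    ∃ h, l.headI < h ∧ ∃ Y, Chain P Y (h :: l) := by
  obtain ⟨Y, hY⟩ := hl
  have hlt {x : ℕ} (hx : x ∈ l) : x < l.sum + 1 := Nat.lt_succ_of_le (List.le_sum_of_mem hx)
  have hinf : (Y \ Set.Iio (l.sum + 1)).Infinite := hY.infinite.sdiff (Set.finite_Iio _)
  obtain ⟨f, hf, hfY, e, he⟩ := exists_homogeneous_subsequence hinf
    fun a b => typ l.length n (Set.Ico a b) (predLabel P)
  have hf0 (i : ℕ) : l.sum + 1 ≤ f i := by simpa using (hfY i).2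
  refine ⟨f 0, ?_, {y ∈ Y | y < l.sum + 1} ∪ Set.range f, ⟨⟨.inr ⟨0, rfl⟩, ?_⟩, ?_⟩⟩
  · refine lt_of_lt_of_le ?_ (hf0 0)
    cases l with
    | nil => simp
    | cons a l => exact hlt (by simp)
  · have key {a : ℕ} (ha : a ∈ {y ∈ Y | y < l.sum + 1} ∪ Set.range f) (h : f 0 ≤ a) :
        ∃ i, f i = a := by
      rcases ha with ha | ha
      · have := ha.2
        have := hf0 0
        omega
      · exact ha
    intro a ha b hb a' ha' b' hb' h0 hab h0' hab'
    obtain ⟨i, rfl⟩ := key ha h0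
    obtain ⟨j, rfl⟩ := key hb (by omega)
    obtain ⟨i', rfl⟩ := key ha' h0'
    obtain ⟨j', rfl⟩ := key hb' (by omega)
    exact (he i j (hf.lt_iff_lt.1 hab)).trans (he i' j' (hf.lt_iff_lt.1 hab')).symm
  · refine hY.mono ?_ ?_ fun x hx => .inl ⟨hY.mem hx, hlt hx⟩
    · rintro x (hx | ⟨i, rfl⟩)
      exacts [hx.1, (hfY i).1]
    · exact (Set.infinite_range_of_injective hf.injective).mono Set.subset_union_right

namespace MSO

variable {v : ℕ → ℕ} {V : ℕ → Set ℕ}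

/-- The formula expressing `HomogeneousFrom` for the set variable `0`. -/
def homogeneousFrom (k h : ℕ) : MSO n :=
  .ex1 0 (.and (num h) (.and (.mem 0 0) (.ex1 6 (.and (eq 6 0)
    (.not (.ex1 0 (.ex1 1 (.ex1 2 (.ex1 3 (.and
      (.and (.and (.and (.mem 0 0) (.mem 1 0)) (.and (.mem 2 0) (.mem 3 0)))
        (.and (.and (.not (.lt 0 6)) (.lt 0 1)) (.and (.not (.lt 2 6)) (.lt 2 3))))
      (.not (sameType (k + n) k))))))))))))

theorem sat_homogeneousFrom (k h : ℕ) :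
    (homogeneousFrom k h : MSO n).Sat (· < ·) P v V ↔ HomogeneousFrom P (V 0) k h := by
  have hlabel (D : Set ℕ) (s : ℕ) : typ k n D (varLabel P V s) = typ k n D (predLabel P) :=
    typ_congr fun i hi x _ => by simp [varLabel, predLabel, hi]
  simp only [homogeneousFrom, Sat, sat_num, sat_eq, sat_sameType k le_rfl, hlabel,
    Function.update_self, Function.update_of_ne, ne_eq, OfNat.ofNat_ne_zero, OfNat.zero_ne_ofNat,
    OfNat.ofNat_ne_one, OfNat.one_ne_ofNat, zero_ne_one, not_false_eq_true,
    not_exists, not_and, not_not, not_lt, exists_eq_left, HomogeneousFrom,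
    show ¬ (2 : ℕ) = 3 by decide, show ¬ (6 : ℕ) = 3 by decide, show ¬ (6 : ℕ) = 2 by decide]
  refine and_congr_right fun _ => ?_
  constructor
  · intro H a ha b hb a' ha' b' hb' h1 h2 h3 h4
    exact H a b a' b' ⟨⟨⟨ha, hb⟩, ha', hb'⟩, ⟨h1, h2⟩, h3, h4⟩
  · rintro H a b a' b' ⟨⟨⟨ha, hb⟩, ha', hb'⟩, ⟨h1, h2⟩, h3, h4⟩
    exact H a ha b hb a' ha' b' hb' h1 h2 h3 h4

theorem primrec₂_encode_homogeneousFrom :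
    Primrec₂ fun k h => (homogeneousFrom k h : MSO n).encode := by
  have hs : Primrec fun x : ℕ × ℕ => (sameType (x.1 + n) x.1 : MSO n).encode :=
    primrec₂_encode_sameType.comp (Primrec.nat_add.comp Primrec.fst (Primrec.const n)) Primrec.fst
  have hex (i : ℕ) {φ : ℕ × ℕ → MSO n} (hφ : Primrec fun a => (φ a).encode) :
      Primrec fun a => (MSO.ex1 i (φ a)).encode := primrec_encode_ex1 (Primrec.const i) hφ
  exact hex 0 (primrec_encode_and (primrec_encode_num.comp Primrec.snd)
    (primrec_encode_and (Primrec.const _) (hex 6 (primrec_encode_and (Primrec.const _)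
      (primrec_encode_not (hex 0 (hex 1 (hex 2 (hex 3 (primrec_encode_and (Primrec.const _)
        (primrec_encode_not hs)))))))))))

/-- The formula expressing `Chain` for the set variable `0`. -/
def chain : List ℕ → MSO n
  | [] => .not (.ex1 0 (.not (.ex1 1 (.and (.lt 0 1) (.mem 1 0)))))
  | h :: l => .and (homogeneousFrom l.length h) (chain l)

theorem sat_chain (l : List ℕ) :
    (chain l : MSO n).Sat (· < ·) P v V ↔ Chain P (V 0) l := by
  induction l with
  | nil => simp [chain, Sat, Chain, Set.infinite_iff_exists_gt, and_comm]
  | cons h l ih => simp only [chain, Sat, Chain, ih, sat_homogeneousFrom]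

theorem primrec_encode_chain : Primrec fun l => (chain l : MSO n).encode := by
  have hstep : Primrec₂ fun (_ : List ℕ) (x : ℕ × ℕ × ℕ) => (Nat.pair 4 (Nat.pair
      (homogeneousFrom x.2.2 x.1 : MSO n).encode x.2.1), x.2.2 + 1) := by
    have h1 : Primrec fun x : List ℕ × ℕ × ℕ × ℕ => x.2.1 := Primrec.fst.comp Primrec.snd
    have h2 : Primrec fun x : List ℕ × ℕ × ℕ × ℕ => x.2.2.1 :=
      Primrec.fst.comp (Primrec.snd.comp Primrec.snd)
    have h3 : Primrec fun x : List ℕ × ℕ × ℕ × ℕ => x.2.2.2 :=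
      Primrec.snd.comp (Primrec.snd.comp Primrec.snd)
    exact Primrec.pair (Primrec₂.natPair.comp (Primrec.const 4) (Primrec₂.natPair.comp
      (primrec₂_encode_homogeneousFrom.comp h3 h1) h2)) (Primrec.succ.comp h3)
  refine (Primrec.fst.comp (Primrec.list_foldr Primrec.id
    (Primrec.const ((chain [] : MSO n).encode, 0)) hstep)).of_eq fun l => ?_
  have (l : List ℕ) : l.foldr (fun h s => (Nat.pair 4 (Nat.pair
      (homogeneousFrom s.2 h : MSO n).encode s.1), s.2 + 1)) ((chain [] : MSO n).encode, 0) =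
      ((chain l : MSO n).encode, l.length) := by
    induction l with
    | nil => rfl
    | cons h l ih =>
      rw [List.foldr_cons, ih]
      rfl
  exact congrArg Prod.fst (this l)

end MSO

theorem computablePred_exists_chain
    (hT : DecidableSet (MSO.TheoryCodes (fun x y : ℕ => x < y) P)) :
    ComputablePred fun l => ∃ Y, Chain P Y l :=
  computablePred_of_formula hT (φ := fun l => .ex2 0 (MSO.chain l))
    (MSO.primrec_encode_ex2 (Primrec.const 0) MSO.primrec_encode_chain)
    fun l v V => by simp [MSO.Sat, MSO.sat_chain]

theorem Chain.homogeneousFrom {Y : Set ℕ} {h : ℕ → ℕ} {F : ℕ → List ℕ} (h0 : F 0 = [])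
    (hF : ∀ k, F (k + 1) = h k :: F k) {K : ℕ} (hc : Chain P Y (F K)) {k : ℕ} (hk : k < K) :
    HomogeneousFrom P Y k (h k) := by
  have hlen (k : ℕ) : (F k).length = k := by
    induction k with
    | zero => simp [h0]
    | succ k ih => simp [hF, ih]
  induction K with
  | zero => omega
  | succ K ih =>
    rw [hF, Chain, hlen] at hc
    obtain rfl | hne := eq_or_ne k K
    exacts [hc.1, ih hc.2 (by omega)]

/-- A sequence each of whose finite initial parts forms a chain is uniformly homogeneous. -/
theorem uniformlyHomogeneous_of_chain {h : ℕ → ℕ} {F : ℕ → List ℕ} (hh : StrictMono h)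
    (h0 : F 0 = []) (hF : ∀ k, F (k + 1) = h k :: F k) (hc : ∀ k, ∃ Y, Chain P Y (F k)) :
    UniformlyHomogeneous P h := by
  refine ⟨hh, fun k i j i' j' hij hij' φ hφ hk => ?_⟩
  obtain ⟨Y, hY⟩ := hc (k + j + j' + 1)
  have hhom {x : ℕ} (hx : x < k + j + j' + 1) := hY.homogeneousFrom h0 hF hx
  have hne {i j : ℕ} (hij : i < j) : Nonempty (Set.Ico (h (k + i)) (h (k + j))) :=
    (Set.nonempty_Ico.2 (hh (by omega))).to_subtype
  have := hne hij
  have := hne hij'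
  refine trueIn_iff_of_typ_eq hφ (represents_predLabel_sub _) (represents_predLabel_sub _) ?_ hk
  simp only [Subtype.range_coe]
  exact (hhom (x := k) (by omega)).2 _ (hhom (by omega)).1 _ (hhom (by omega)).1
    _ (hhom (by omega)).1 _ (hhom (by omega)).1 (hh.monotone (by omega)) (hh (by omega))
    (hh.monotone (by omega)) (hh (by omega))

theorem exists_uniformlyHomogeneous
    (hT : DecidableSet (MSO.TheoryCodes (fun x y : ℕ => x < y) P)) :
    ∃ h : ℕ → ℕ, UniformlyHomogeneous P h ∧ DecidableSet (Set.range h) := by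
  classical
  have hgood := (computablePred_exists_chain hT).decide
  have hex (l : List ℕ) :
      ∃ h, (∃ Y, Chain P Y l) → l.headI < h ∧ ∃ Y, Chain P Y (h :: l) := by
    by_cases hl : ∃ Y, Chain P Y l
    · obtain ⟨h, hh⟩ := exists_chain_cons hl
      exact ⟨h, fun _ => hh⟩
    · exact ⟨0, fun h => absurd h hl⟩
  have hcomp : ComputablePred fun a : List ℕ × ℕ =>
      (∃ Y, Chain P Y a.1) → a.1.headI < a.2 ∧ ∃ Y, Chain P Y (a.2 :: a.1) := by
    rw [computablePred_iff_computable_decide]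
    have hlt : PrimrecPred fun a : List ℕ × ℕ => a.1.headI < a.2 :=
      Primrec.nat_lt.comp (Primrec.list_headI.comp Primrec.fst) Primrec.snd
    refine (Primrec.or.to_comp.comp (Primrec.not.to_comp.comp (hgood.comp Computable.fst))
      (Primrec.and.to_comp.comp hlt.decide.to_comp
        (hgood.comp (Computable.list_cons.comp Computable.snd Computable.fst)))).of_eq fun a => ?_
    by_cases h : ∃ Y, Chain P Y a.1 <;> simp [h]
  let next (l : List ℕ) : ℕ := Nat.find (hex l)
  have hnext : Computable next := Computable.find hcomp hex
  let F (k : ℕ) : List ℕ := k.rec [] fun _ l => next l :: l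
  have hF : Computable F := Computable.nat_rec .id (Computable.const [])
    (Computable.list_cons.comp (hnext.comp (Computable.snd.comp Computable.snd))
      (Computable.snd.comp Computable.snd)).to₂
  have hFgood (k : ℕ) : ∃ Y, Chain P Y (F k) := by
    induction k with
    | zero => exact ⟨Set.univ, Set.infinite_univ⟩
    | succ k ih => exact (Nat.find_spec (hex (F k)) ih).2
  have hmono : StrictMono fun k => next (F k) :=
    strictMono_nat_of_lt_succ fun k => (Nat.find_spec (hex (F (k + 1))) (hFgood (k + 1))).1
  have hmem (x k : ℕ) : x ∈ F k ↔ ∃ i < k, next (F i) = x := by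
    induction k with
    | zero => simp [F]
    | succ k ih =>
      rw [show F (k + 1) = next (F k) :: F k from rfl, List.mem_cons, ih, Nat.exists_lt_succ_right]
      exact or_comm.trans (or_congr_right eq_comm)
  refine ⟨fun k => next (F k), uniformlyHomogeneous_of_chain hmono rfl (fun _ => rfl) hFgood, ?_⟩
  refine (computablePred_iff_computable_decide.2 ((PrimrecPred.list_mem Primrec.fst
    Primrec.snd).decide.to_comp.comp (Computable.id.pair (hF.comp Computable.succ)))).of_eq
    fun x => ?_
  simp only [id, hmem, Set.mem_range]
  exact ⟨fun ⟨i, _, hi⟩ => ⟨i, hi⟩,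
    fun ⟨i, hi⟩ => ⟨i, Nat.lt_succ_of_le (hi ▸ hmono.le_apply), hi⟩⟩

end chains

end Paper

open Paper

/-- For every labelled linear ordering `M = (ℕ, <, P₁, …, Pₙ)`, the MSO theory
of `M` is decidable iff each `Pᵢ` is a computable subset of `ℕ` and there is a
computable set `H = {h 0 < h 1 < ⋯}` that is uniformly homogeneous for `M`. -/
theorem stmt_12 {n : ℕ} (P : Fin n → Set ℕ) :
    DecidableSet (MSO.TheoryCodes (fun x y : ℕ => x < y) P) ↔
      ((∀ i : Fin n, DecidableSet (P i)) ∧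
        ∃ h : ℕ → ℕ, UniformlyHomogeneous P h ∧ DecidableSet (Set.range h)) := by
  exact ⟨fun hT => ⟨decidableSet_pred hT, exists_uniformlyHomogeneous hT⟩,
    fun ⟨hP, _, hh, hd⟩ => decidableSet_theoryCodes hP hh hd⟩
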